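/- arXiv:0705.4564 — 8 statements merged into one kernel-verified Lean document; each statement's English description precedes it below -/
import Mathlib

section
/- Let 0 < α < 1 and C₁, C₂ > 0. Then there exists a constant C₃ > 0 depending only on α, C₁, C₂ with the following property. Let p : 𝔻 × ℝ → ℂ be such that for each t the map z ↦ p(z,t) is continuous on 𝔻 with Re p(z,t) > 0 and satisfies |p(z,t)| ≤ C₁·(1−|z|)^{−α}·Re p(z,t) and Re p(z,t) ≥ C₂·(1−|z|)^{α} for all z ∈ 𝔻 and all t. If w : [t₁,t₂] → 𝔻 is differentiable, satisfies dw/dt = −w(t)·p(w(t),t) on [t₁,t₂], and 1/2 ≤ r ≤ |w(t)| < 1 for all t ∈ [t₁,t₂], then the length of the space-time integral curve satisfies ∫_{t₁}^{t₂} √(|w'(t)|² + 1) dt ≤ C₃·(1−r)^{1−α}. -/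
open Complex Set

/-- Under the estimates `|p| ≤ C₁ (1-|z|)^{-α} Re p` and `Re p ≥ C₂ (1-|z|)^α`,
the arclength of the space-time integral curve of the Loewner–Kufarev ODE lying in the
cylinder `r ≤ |w| < 1` (with `1/2 ≤ r`) is at most `C₃ (1-r)^{1-α}`. -/
theorem loewner_kufarev_integral_curve_length
    (α C₁ C₂ : ℝ) (hα : 0 < α) (hα1 : α < 1) (hC₁ : 0 < C₁) (hC₂ : 0 < C₂) :
    ∃ C₃ > 0, ∀ (p : ℂ → ℝ → ℂ),
      (∀ t : ℝ, ContinuousOn (fun z => p z t) (Metric.ball (0 : ℂ) 1)) →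
      (∀ t : ℝ, ∀ z ∈ Metric.ball (0 : ℂ) 1, 0 < (p z t).re) →
      (∀ t : ℝ, ∀ z ∈ Metric.ball (0 : ℂ) 1,
        ‖p z t‖ ≤ C₁ * (p z t).re / (1 - ‖z‖) ^ α) →
      (∀ t : ℝ, ∀ z ∈ Metric.ball (0 : ℂ) 1,
        (p z t).re ≥ C₂ * (1 - ‖z‖) ^ α) →
      ∀ (w : ℝ → ℂ) (t₁ t₂ r : ℝ), t₁ ≤ t₂ → 1 / 2 ≤ r →
      (∀ t ∈ Icc t₁ t₂, r ≤ ‖w t‖ ∧ ‖w t‖ < 1) →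
      (∀ t ∈ Icc t₁ t₂, HasDerivWithinAt w (-(w t * p (w t) t)) (Icc t₁ t₂) t) →
      ∫ t in t₁..t₂, Real.sqrt (‖w t * p (w t) t‖ ^ 2 + 1) ≤ C₃ * (1 - r) ^ (1 - α) := by
  have h1α : 0 < 1 - α := by linarith
  refine ⟨(C₁ + 2 / C₂) / (1 - α), by positivity, ?_⟩
  intro p _ hre hp1 hp2 w t₁ t₂ r ht hr hw hd
  have hK : 0 < C₁ + 2 / C₂ := by positivity
  have hr1 : r < 1 := (hw t₁ ⟨le_rfl, ht⟩).1.trans_lt (hw t₁ ⟨le_rfl, ht⟩).2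
  by_cases hint : IntervalIntegrable (fun t => Real.sqrt (‖w t * p (w t) t‖ ^ 2 + 1))
      MeasureTheory.volume t₁ t₂
  swap
  · rw [intervalIntegral.integral_undef hint]
    have : 0 < 1 - r := by linarith
    positivity
  have hcont : ContinuousOn w (Icc t₁ t₂) := fun t h => (hd t h).continuousWithinAt
  set g : ℝ → ℝ := fun t => (C₁ + 2 / C₂) / (1 - α) * (1 - ‖w t‖) ^ (1 - α) with hg
  have key : ∫ t in t₁..t₂, Real.sqrt (‖w t * p (w t) t‖ ^ 2 + 1) ≤ g t₂ - g t₁ := by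
    apply intervalIntegral.integral_le_sub_of_hasDeriv_right_of_le ht
      (g' := fun t => (C₁ + 2 / C₂) * ((1 - ‖w t‖) ^ (-α) * (‖w t‖ * (p (w t) t).re)))
    · apply ContinuousOn.mul continuousOn_const
      apply ContinuousOn.rpow_const
      · exact continuousOn_const.sub hcont.norm
      · intro t h
        right
        exact h1α.le
    · intro t h
      have hI := Ioo_subset_Icc_self h
      have hD : HasDerivAt w (-(w t * p (w t) t)) t :=
        (hd t hI).hasDerivAt (Icc_mem_nhds h.1 h.2)
      have h0 : 0 < ‖w t‖ := by linarith [(hw t hI).1]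
      have hu : 0 < 1 - ‖w t‖ := by linarith [(hw t hI).2]
      have hn2 := hD.norm_sq
      have hn := hn2.sqrt (by positivity)
      have hin : inner ℝ (w t) (-(w t * p (w t) t)) = -(‖w t‖ ^ 2 * (p (w t) t).re) := by
        rw [Complex.inner, ← Complex.normSq_eq_norm_sq, Complex.normSq_apply]
        simp
        ring
      have hn' : HasDerivAt (fun t => ‖w t‖) (-(‖w t‖ * (p (w t) t).re)) t := by
        convert hn using 1
        · funext s
          simp
        · rw [hin, Real.sqrt_sq (norm_nonneg _)]
          field_simp
      have h3 := ((hn'.const_sub 1).rpow_const (p := 1 - α) (Or.inl hu.ne')).const_mul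
        ((C₁ + 2 / C₂) / (1 - α))
      apply HasDerivAt.hasDerivWithinAt
      refine h3.congr_deriv ?_
      rw [show 1 - α - 1 = -α by ring]
      field_simp
    · exact (intervalIntegrable_iff_integrableOn_Icc_of_le ht).1 hint
    · intro t h
      have hI := Ioo_subset_Icc_self h
      have h0 : 1 / 2 ≤ ‖w t‖ := by linarith [(hw t hI).1]
      have hu : 0 < 1 - ‖w t‖ := by linarith [(hw t hI).2]
      have hb : w t ∈ Metric.ball (0 : ℂ) 1 := by simpa using (hw t hI).2
      have e1 := hp1 t _ hb
      have e2 := hp2 t _ hb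
      have e0 := hre t _ hb
      have hx : 0 < (1 - ‖w t‖) ^ α := Real.rpow_pos_of_pos hu _
      rw [Real.rpow_neg hu.le]
      set x := (1 - ‖w t‖) ^ α
      set q := (p (w t) t).re
      have a1 : ‖w t * p (w t) t‖ ≤ C₁ * (x⁻¹ * (‖w t‖ * q)) := by
        rw [norm_mul]
        calc _ ≤ ‖w t‖ * (C₁ * q / x) := by gcongr
          _ = _ := by field_simp
      have a2 : 1 ≤ 2 / C₂ * (x⁻¹ * (‖w t‖ * q)) := by
        have : 2 / C₂ * (x⁻¹ * (‖w t‖ * q)) = (2 * ‖w t‖ * q) / (C₂ * x) := by field_simp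
        rw [this, le_div_iff₀ (by positivity)]
        nlinarith
      have a3 : Real.sqrt (‖w t * p (w t) t‖ ^ 2 + 1) ≤ ‖w t * p (w t) t‖ + 1 := by
        apply Real.sqrt_le_iff.2
        constructor
        · positivity
        · nlinarith [norm_nonneg (w t * p (w t) t)]
      linarith
  have hu1 : 0 < 1 - ‖w t₁‖ := by linarith [(hw t₁ ⟨le_rfl, ht⟩).2]
  have hu2 : 0 < 1 - ‖w t₂‖ := by linarith [(hw t₂ ⟨ht, le_rfl⟩).2]
  have g1 : 0 ≤ g t₁ := by positivity
  have g2 : g t₂ ≤ (C₁ + 2 / C₂) / (1 - α) * (1 - r) ^ (1 - α) := by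
    simp only [hg]
    gcongr
    exact (hw t₂ ⟨ht, le_rfl⟩).1
  linarith
end

section
/- Let 0 < α < 1 and C₁, C₂ > 0, and let p : 𝔻 × ℝ → ℂ be such that for each t the map z ↦ p(z,t) is continuous on 𝔻 with Re p(z,t) > 0 and satisfies |p(z,t)| ≤ C₁·(1−|z|)^{−α}·Re p(z,t) and Re p(z,t) ≥ C₂·(1−|z|)^{α} for all z ∈ 𝔻 and all t. Suppose w : (τ, t₀] → 𝔻 is differentiable, satisfies dw/dt = −w(t)·p(w(t),t), and |w(t)| → 1 as t → τ⁺. Then there exists γ ∈ ℂ with |γ| = 1 such that w(t) → γ as t → τ⁺. -/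
open Complex Set Filter Topology

/-- Under the estimates `|p| ≤ C₁ (1-|z|)^{-α} Re p` and `Re p ≥ C₂ (1-|z|)^α`,
a solution of the Loewner–Kufarev ODE on `(τ, t₀]` whose modulus tends to `1` as `t → τ⁺`
converges to a boundary point `γ` with `|γ| = 1`. -/
theorem loewner_kufarev_boundary_limit
    (α C₁ C₂ : ℝ) (hα : 0 < α) (hα1 : α < 1) (hC₁ : 0 < C₁) (hC₂ : 0 < C₂)
    (p : ℂ → ℝ → ℂ)
    (hp_cont : ∀ t : ℝ, ContinuousOn (fun z => p z t) (Metric.ball (0 : ℂ) 1))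
    (hp_re : ∀ t : ℝ, ∀ z ∈ Metric.ball (0 : ℂ) 1, 0 < (p z t).re)
    (hp_est1 : ∀ t : ℝ, ∀ z ∈ Metric.ball (0 : ℂ) 1,
      ‖p z t‖ ≤ C₁ * (p z t).re / (1 - ‖z‖) ^ α)
    (hp_est2 : ∀ t : ℝ, ∀ z ∈ Metric.ball (0 : ℂ) 1,
      (p z t).re ≥ C₂ * (1 - ‖z‖) ^ α)
    (τ t₀ : ℝ) (hτ : τ < t₀)
    (w : ℝ → ℂ)
    (hw_mem : ∀ t ∈ Ioc τ t₀, w t ∈ Metric.ball (0 : ℂ) 1)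
    (hw_deriv : ∀ t ∈ Ioc τ t₀, HasDerivWithinAt w (-(w t * p (w t) t)) (Ioc τ t₀) t)
    (hw_lim : Tendsto (fun t => ‖w t‖) (𝓝[>] τ) (𝓝 1)) :
    ∃ γ : ℂ, ‖γ‖ = 1 ∧ Tendsto w (𝓝[>] τ) (𝓝 γ) := by
  have hD : ∀ t ∈ Ioo τ t₀, HasDerivAt w (-(w t * p (w t) t)) t := fun t ht =>
    (hw_deriv t ⟨ht.1, ht.2.le⟩).hasDerivAt (Ioc_mem_nhds ht.1 ht.2)
  have hr1 : ∀ t ∈ Ioo τ t₀, ‖w t‖ < 1 := fun t ht => by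
    simpa using hw_mem t ⟨ht.1, ht.2.le⟩
  have hN : ∀ t ∈ Ioo τ t₀, 0 < ‖w t‖ →
      HasDerivAt (fun t => ‖w t‖) (-(‖w t‖ * (p (w t) t).re)) t := by
    intro t ht h0
    have h1 := (hD t ht).norm_sq
    have h2 := h1.sqrt (by positivity)
    simp only [Real.sqrt_sq (norm_nonneg _)] at h2
    convert h2 using 1
    have : inner ℝ (w t) (-(w t * p (w t) t)) = -(‖w t‖ ^ 2 * (p (w t) t).re) := by
      rw [Complex.inner, ← Complex.normSq_eq_norm_sq, Complex.normSq_apply]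
      simp
      ring
    rw [this]
    field_simp
  let B : ℝ → ℝ := fun t => C₁ / (1 - α) * (1 - ‖w t‖) ^ (1 - α)
  have hα' : 0 < 1 - α := by linarith
  have hB : ∀ t ∈ Ioo τ t₀, 0 < ‖w t‖ →
      HasDerivAt B (C₁ * (‖w t‖ * (p (w t) t).re) / (1 - ‖w t‖) ^ α) t := by
    intro t ht h0
    have hpos : 0 < 1 - ‖w t‖ := by linarith [hr1 t ht]
    have h1 := (((hN t ht h0).const_sub 1).rpow_const (p := 1 - α)
      (Or.inl hpos.ne')).const_mul (C₁ / (1 - α))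
    refine HasDerivAt.congr_deriv (f := B) h1 ?_
    rw [show 1 - α - 1 = -α by ring, Real.rpow_neg hpos.le]
    field_simp
  have hB0 : Tendsto B (𝓝[>] τ) (𝓝 0) := by
    have h1 : Tendsto (fun t => 1 - ‖w t‖) (𝓝[>] τ) (𝓝 0) := by
      simpa using hw_lim.const_sub 1
    have h2 := (h1.rpow_const (p := 1 - α) (Or.inr hα'.le)).const_mul (C₁ / (1 - α))
    simpa [Real.zero_rpow hα'.ne'] using h2
  have key : ∀ s t, τ < s → s ≤ t → t < t₀ → (∀ x ∈ Icc s t, 0 < ‖w x‖) →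
      ‖w t - w s‖ ≤ B t - B s := by
    intro s t hs hst ht h0
    have hI : ∀ x ∈ Icc s t, x ∈ Ioo τ t₀ := fun x hx =>
      ⟨hs.trans_le hx.1, hx.2.trans_lt ht⟩
    refine image_norm_le_of_norm_deriv_right_le_deriv_boundary'
      (f := fun x => w x - w s) (f' := fun x => -(w x * p (w x) x))
      (B := fun x => B x - B s)
      (B' := fun x => C₁ * (‖w x‖ * (p (w x) x).re) / (1 - ‖w x‖) ^ α)
      (a := s) (b := t) ?_ ?_ ?_ ?_ ?_ ?_ (right_mem_Icc.2 hst)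
    · intro x hx
      exact ((hD x (hI x hx)).sub_const _).continuousAt.continuousWithinAt
    · intro x hx
      exact ((hD x (hI x (Ico_subset_Icc_self hx))).sub_const _).hasDerivWithinAt
    · simp
    · intro x hx
      exact ((hB x (hI x hx) (h0 x hx)).sub_const _).continuousAt.continuousWithinAt
    · intro x hx
      have hx := Ico_subset_Icc_self hx
      exact ((hB x (hI x hx) (h0 x hx)).sub_const _).hasDerivWithinAt
    · intro x hx
      have hx := hI x (Ico_subset_Icc_self hx)
      have := hp_est1 x (w x) (hw_mem x ⟨hx.1, hx.2.le⟩)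
      rw [norm_neg, norm_mul]
      calc _ ≤ ‖w x‖ * (C₁ * (p (w x) x).re / (1 - ‖w x‖) ^ α) := by gcongr
        _ = _ := by ring
  have hC : Cauchy (map w (𝓝[>] τ)) := by
    rw [Metric.cauchy_iff]
    refine ⟨inferInstance, fun ε hε => ?_⟩
    have e1 : ∀ᶠ t in 𝓝[>] τ, B t < ε := hB0.eventually (gt_mem_nhds hε)
    have e2 : ∀ᶠ t in 𝓝[>] τ, 0 < ‖w t‖ := hw_lim.eventually (lt_mem_nhds one_pos)
    have e3 : ∀ᶠ t in 𝓝[>] τ, t < t₀ := nhdsWithin_le_nhds (gt_mem_nhds hτ)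
    obtain ⟨u, hu, hsub⟩ := mem_nhdsGT_iff_exists_Ioo_subset.1 (e1.and (e2.and e3))
    refine ⟨w '' Ioo τ u, image_mem_map (Ioo_mem_nhdsGT hu), ?_⟩
    have main : ∀ s ∈ Ioo τ u, ∀ t ∈ Ioo τ u, s ≤ t → ‖w t - w s‖ < ε := by
      intro s hs t ht hst
      have h1 := key s t hs.1 hst (hsub ht).2.2 (fun x hx =>
        (hsub (show x ∈ Ioo τ u from ⟨hs.1.trans_le hx.1, hx.2.trans_lt ht.2⟩)).2.1)
      have h2 : 0 ≤ B s := by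
        have : 0 ≤ 1 - ‖w s‖ := by linarith [hr1 s ⟨hs.1, (hsub hs).2.2⟩]
        positivity
      have h3 : B t < ε := (hsub ht).1
      linarith
    rintro _ ⟨s, hs, rfl⟩ _ ⟨t, ht, rfl⟩
    rcases le_total s t with h | h
    · rw [dist_comm, dist_eq_norm]
      exact main s hs t ht h
    · rw [dist_eq_norm]
      exact main t ht s hs h
  obtain ⟨γ, hγ⟩ := CompleteSpace.complete hC
  have hγ' : Tendsto w (𝓝[>] τ) (𝓝 γ) := hγ
  exact ⟨γ, tendsto_nhds_unique hγ'.norm hw_lim, hγ'⟩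
end

section
/- Let w be holomorphic on the open unit disc 𝔻 with |w'(z) − 1| ≤ 1/4 for all z ∈ 𝔻. Then for any three points z₁, z₂, z₃ ∈ 𝔻 with z₁ ≠ z₃, |w(z₁) − w(z₂)| · |z₁ − z₃| ≤ (5/3) · |z₁ − z₂| · |w(z₁) − w(z₃)|. -/
open Complex Set

/-- Three-point quasisymmetry estimate: if `w` is holomorphic on the unit disc
with `|w'(z) - 1| ≤ 1/4`, then `|w z₁ - w z₂|·|z₁ - z₃| ≤ (5/3)·|z₁ - z₂|·|w z₁ - w z₃|`. -/
theorem three_point_distortion_of_deriv_near_one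
    (w : ℂ → ℂ)
    (hw : DifferentiableOn ℂ w (Metric.ball (0 : ℂ) 1))
    (hw' : ∀ z ∈ Metric.ball (0 : ℂ) 1, ‖deriv w z - 1‖ ≤ 1 / 4) :
    ∀ z₁ ∈ Metric.ball (0 : ℂ) 1, ∀ z₂ ∈ Metric.ball (0 : ℂ) 1,
      ∀ z₃ ∈ Metric.ball (0 : ℂ) 1, z₁ ≠ z₃ →
      ‖w z₁ - w z₂‖ * ‖z₁ - z₃‖ ≤ 5 / 3 * (‖z₁ - z₂‖ * ‖w z₁ - w z₃‖) := by
  have key : ∀ x ∈ Metric.ball (0 : ℂ) 1, ∀ y ∈ Metric.ball (0 : ℂ) 1,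
      ‖(w y - y) - (w x - x)‖ ≤ 1 / 4 * ‖y - x‖ := by
    intro x hx y hy
    refine Convex.norm_image_sub_le_of_norm_hasDerivWithin_le
      (f := fun z => w z - z) (f' := fun z => deriv w z - 1) (s := Metric.ball (0 : ℂ) 1)
      ?_ hw' (convex_ball _ _) hx hy
    intro z hz
    exact (((hw.differentiableAt (Metric.isOpen_ball.mem_nhds hz)).hasDerivAt).sub
      (hasDerivAt_id z)).hasDerivWithinAt
  intro z₁ h₁ z₂ h₂ z₃ h₃ _
  have a : ‖w z₁ - w z₂‖ ≤ 5 / 4 * ‖z₁ - z₂‖ := by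
    have h := key z₂ h₂ z₁ h₁
    have t := norm_add_le ((w z₁ - z₁) - (w z₂ - z₂)) (z₁ - z₂)
    have e : (w z₁ - z₁) - (w z₂ - z₂) + (z₁ - z₂) = w z₁ - w z₂ := by ring
    rw [e] at t
    linarith
  have b : 3 / 4 * ‖z₁ - z₃‖ ≤ ‖w z₁ - w z₃‖ := by
    have h := key z₃ h₃ z₁ h₁
    have t := norm_sub_le (w z₁ - w z₃) ((w z₁ - z₁) - (w z₃ - z₃))
    have e : (w z₁ - w z₃) - ((w z₁ - z₁) - (w z₃ - z₃)) = z₁ - z₃ := by ring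
    rw [e] at t
    linarith
  have c := mul_le_mul_of_nonneg_right a (norm_nonneg (z₁ - z₃))
  have d := mul_le_mul_of_nonneg_left b (norm_nonneg (z₁ - z₂))
  linarith
end

section
/- For every k with 0 < k < 1 there exists a constant C > 0 depending only on k such that: for every function p holomorphic on the open unit disc 𝔻 with p(0) = 1 and Re p(z) ≥ k for all z ∈ 𝔻, one has |p(z)| ≤ C·(1−|z|)^{−1/2}·Re p(z) for all z ∈ 𝔻. -/
open Complex Set

/-- For every `0 < k < 1` there is `C > 0` such that every holomorphic `p` on
the unit disc with `p 0 = 1` and `Re p ≥ k` satisfies `|p z| ≤ C (1-|z|)^{-1/2} Re p z`. -/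
theorem halfplane_class_estimate
    (k : ℝ) (hk : 0 < k) (hk1 : k < 1) :
    ∃ C > 0, ∀ p : ℂ → ℂ,
      DifferentiableOn ℂ p (Metric.ball (0 : ℂ) 1) →
      p 0 = 1 →
      (∀ z ∈ Metric.ball (0 : ℂ) 1, k ≤ (p z).re) →
      ∀ z ∈ Metric.ball (0 : ℂ) 1,
        ‖p z‖ ≤ C * (p z).re / (1 - ‖z‖) ^ ((1 : ℝ) / 2) := by
  refine ⟨√(4 / k + 1), by positivity, ?_⟩
  intro p hp h0 hre z hz
  have hsq : ∀ w : ℂ, ‖w‖ ^ 2 = w.re ^ 2 + w.im ^ 2 := fun w => by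
    rw [Complex.sq_norm, Complex.normSq_apply]; ring
  have hne : ∀ w ∈ Metric.ball (0 : ℂ) 1, p w + 1 - k ≠ 0 := by
    intro w hw h
    have := congrArg Complex.re h
    simp at this
    linarith [hre w hw]
  have hd : DifferentiableOn ℂ (fun w => (p w - 1) / (p w + 1 - k)) (Metric.ball (0 : ℂ) 1) :=
    (hp.sub_const 1).div ((hp.add_const 1).sub_const _) hne
  have hm : MapsTo (fun w => (p w - 1) / (p w + 1 - k)) (Metric.ball (0 : ℂ) 1)
      (Metric.closedBall (0 : ℂ) 1) := by
    intro w hw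
    have h1 := hre w hw
    simp only [mem_closedBall_zero_iff, norm_div]
    rw [div_le_one (norm_pos_iff.mpr (hne w hw))]
    apply le_of_sq_le_sq _ (norm_nonneg _)
    rw [hsq, hsq]
    simp
    nlinarith
  have hz' : ‖z‖ < 1 := by simpa using hz
  have hS := Complex.norm_le_norm_of_mapsTo_ball hd hm (by simp [h0]) hz'
  have hx := hre z hz
  simp only [norm_div] at hS
  rw [div_le_iff₀ (norm_pos_iff.mpr (hne z hz))] at hS
  have hS2 := pow_le_pow_left₀ (norm_nonneg _) hS 2
  rw [mul_pow, hsq (p z - 1), hsq (p z + 1 - k)] at hS2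
  simp at hS2
  rw [← Real.sqrt_eq_rpow]
  have hr : 0 < 1 - ‖z‖ := by linarith
  rw [le_div_iff₀ (Real.sqrt_pos.mpr hr)]
  have hr0 := norm_nonneg z
  apply le_of_sq_le_sq _ (mul_nonneg (Real.sqrt_nonneg _) (by linarith))
  rw [mul_pow, mul_pow, Real.sq_sqrt hr.le, Real.sq_sqrt (by positivity), hsq (p z)]
  generalize ‖z‖ = r at *
  generalize (p z).re = x at *
  generalize (p z).im = y at *
  have e : (4 / k + 1) * x ^ 2 = 4 * (x * (x / k)) + x ^ 2 := by field_simp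
  have e1 : 1 ≤ x / k := (one_le_div hk).mpr hx
  have e2 : x ≤ x * (x / k) := by nlinarith
  have hx0 : 0 < x := by linarith
  -- with u = x - k/2, a = 1 - k/2
  have key : (1 - r ^ 2) * ((x - k/2) ^ 2 + y ^ 2 + (1 - k/2) ^ 2)
      ≤ 2 * (1 - k/2) * (x - k/2) * (1 + r ^ 2) := by nlinarith
  have k1 : 2 * (1 - k/2) * (x - k/2) * (1 + r ^ 2) ≤ 4 * x := by
    have a1 : (1 - k/2) * (x - k/2) ≤ x := by nlinarith
    have a0 : 0 ≤ (1 - k/2) * (x - k/2) := mul_nonneg (by linarith) (by linarith)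
    have a2 : 1 + r ^ 2 ≤ 2 := by nlinarith
    have a3 := mul_le_mul_of_nonneg_left a2 a0
    linarith
  have k2 : (1 - r) * y ^ 2 ≤ (1 - r ^ 2) * ((x - k/2) ^ 2 + y ^ 2 + (1 - k/2) ^ 2) := by
    apply mul_le_mul <;> nlinarith [sq_nonneg (x - k/2), sq_nonneg (1 - k/2), sq_nonneg y]
  have k3 : (1 - r) * x ^ 2 ≤ x ^ 2 := by nlinarith [sq_nonneg x]
  rw [e]
  nlinarith
end

section
/- Let 0 < a < 1 < b. Let p : 𝔻 × [0,∞) → ℂ be such that for each t the map z ↦ p(z,t) is holomorphic on 𝔻 with p(0,t) = 1 and a < Re p(z,t) < b for all z ∈ 𝔻. Let w : 𝔻 × [0,∞) → 𝔻 satisfy w(z,0) = z, for each z ∈ 𝔻 the map t ↦ w(z,t) is differentiable with ∂w/∂t = −w·p(w,t), and for each t the map z ↦ w(z,t) is holomorphic and injective on 𝔻. Then for each t ≥ 0 there exist β ∈ (0,1), M > 0 and a continuous injective map W : closure(𝔻) → ℂ extending z ↦ w(z,t) such that |W(z₁) − W(z₂)| ≤ M·|z₁ − z₂|^{β} for all z₁,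 z₂ in the closed unit disc; in particular the boundary of the domain w(𝔻,t) is a Jordan curve (the injective continuous image of the unit circle under W). -/
open Complex Set

lemma lk_sp (q : ℂ → ℂ) (hq : DifferentiableOn ℂ q (Metric.ball 0 1))
    (hre : ∀ z ∈ Metric.ball (0 : ℂ) 1, 0 < (q z).re) (w₁ w₂ : ℂ)
    (h₁ : w₁ ∈ Metric.ball (0 : ℂ) 1) (h₂ : w₂ ∈ Metric.ball (0 : ℂ) 1) :
    ‖q w₁ - q w₂‖ ^ 2 * ((1 - ‖w₁‖ ^ 2) * (1 - ‖w₂‖ ^ 2)) ≤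
      4 * ((q w₁).re * (q w₂).re) * ‖w₁ - w₂‖ ^ 2 := by
  have hn₁ : ‖w₁‖ < 1 := by simpa using h₁
  have hn₂ : ‖w₂‖ < 1 := by simpa using h₂
  have hs₁ : ‖w₁‖ ^ 2 < 1 := by nlinarith [norm_nonneg w₁]
  have hs₂ : ‖w₂‖ ^ 2 < 1 := by nlinarith [norm_nonneg w₂]
  have hden : ∀ u : ℂ, ‖u‖ < 1 → 1 + (starRingEnd ℂ) w₁ * u ≠ 0 := by
    intro u hu h
    have h' : ‖(starRingEnd ℂ) w₁ * u‖ < 1 := by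
      rw [norm_mul, RCLike.norm_conj]; nlinarith [norm_nonneg u, norm_nonneg w₁]
    have : (starRingEnd ℂ) w₁ * u = -1 := by linear_combination h
    rw [this] at h'; simp at h'
  have hid : ∀ u : ℂ, ‖1 + (starRingEnd ℂ) w₁ * u‖ ^ 2 - ‖u + w₁‖ ^ 2 =
      (1 - ‖w₁‖ ^ 2) * (1 - ‖u‖ ^ 2) := by
    intro u
    simp only [Complex.sq_norm, normSq_apply]
    simp
    ring
  have hid2 : ∀ u v : ℂ, ‖u + (starRingEnd ℂ) v‖ ^ 2 = ‖u - v‖ ^ 2 + 4 * (u.re * v.re) := by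
    intro u v
    simp only [Complex.sq_norm, normSq_apply]
    simp
    ring
  set φ : ℂ → ℂ := fun u => (u + w₁) / (1 + (starRingEnd ℂ) w₁ * u) with hφ
  have hφm : ∀ u ∈ Metric.ball (0 : ℂ) 1, φ u ∈ Metric.ball (0 : ℂ) 1 := by
    intro u hu
    have hu' : ‖u‖ < 1 := by simpa using hu
    have := hden u hu'
    rw [mem_ball_zero_iff, hφ]
    simp only [norm_div]
    rw [div_lt_one (norm_pos_iff.2 this)]
    have hu2 : ‖u‖ ^ 2 < 1 := by nlinarith [norm_nonneg u]
    have h3 := hid u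
    have h4 : 0 < (1 - ‖w₁‖ ^ 2) * (1 - ‖u‖ ^ 2) := mul_pos (by linarith) (by linarith)
    exact lt_of_pow_lt_pow_left₀ 2 (norm_nonneg _) (by linarith)
  have hφd : DifferentiableOn ℂ φ (Metric.ball 0 1) := by
    apply DifferentiableOn.div (by fun_prop) (by fun_prop)
    intro u hu
    exact hden u (by simpa using hu)
  have hqφ : DifferentiableOn ℂ (fun u => q (φ u)) (Metric.ball 0 1) := hq.comp hφd hφm
  have hd2 : ∀ u v : ℂ, 0 < u.re → 0 < v.re → u + (starRingEnd ℂ) v ≠ 0 := by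
    intro u v hu hv h
    have := congrArg Complex.re h
    simp at this; linarith
  set F : ℂ → ℂ := fun u => (q (φ u) - q w₁) / (q (φ u) + (starRingEnd ℂ) (q w₁)) with hF
  have hFd : DifferentiableOn ℂ F (Metric.ball 0 1) := by
    apply DifferentiableOn.div (hqφ.sub_const _) (hqφ.add_const _)
    intro u hu
    exact hd2 _ _ (hre _ (hφm u hu)) (hre _ h₁)
  have hF0 : F 0 = 0 := by simp [hF, hφ]
  have hFm : MapsTo F (Metric.ball 0 1) (Metric.closedBall 0 1) := by
    intro u hu
    have h1 := hre _ (hφm u hu)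
    have h2 := hre _ h₁
    have h3 := hd2 _ _ h1 h2
    rw [mem_closedBall_zero_iff, hF]
    simp only [norm_div]
    rw [div_le_one (norm_pos_iff.2 h3)]
    have := hid2 (q (φ u)) (q w₁)
    have h5 := mul_pos h1 h2
    exact le_of_sq_le_sq (by linarith) (norm_nonneg _)
  have hd3 : 1 - (starRingEnd ℂ) w₁ * w₂ ≠ 0 := by
    have := hden (-w₂) (by simpa using hn₂)
    intro h; apply this; linear_combination h
  set u₀ : ℂ := (w₂ - w₁) / (1 - (starRingEnd ℂ) w₁ * w₂) with hu₀
  have hid3 : ‖1 - (starRingEnd ℂ) w₁ * w₂‖ ^ 2 - ‖w₁ - w₂‖ ^ 2 =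
      (1 - ‖w₁‖ ^ 2) * (1 - ‖w₂‖ ^ 2) := by
    simp only [Complex.sq_norm, normSq_apply]
    simp
    ring
  have hpos : 0 < (1 - ‖w₁‖ ^ 2) * (1 - ‖w₂‖ ^ 2) := mul_pos (by linarith) (by linarith)
  have hu₀n : ‖u₀‖ < 1 := by
    rw [hu₀, norm_div, div_lt_one (norm_pos_iff.2 hd3), norm_sub_rev]
    exact lt_of_pow_lt_pow_left₀ 2 (norm_nonneg _) (by linarith)
  have hφu : φ u₀ = w₂ := by
    have h1 := hden u₀ hu₀n
    simp only [hφ]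
    rw [div_eq_iff h1]
    have hm : u₀ * (1 - (starRingEnd ℂ) w₁ * w₂) = w₂ - w₁ := div_mul_cancel₀ _ hd3
    linear_combination hm
  have hS := norm_le_norm_of_mapsTo_ball hFd hFm hF0 hu₀n
  simp only [hF] at hS
  rw [hφu, hu₀, norm_div, norm_div, div_le_div_iff₀ (norm_pos_iff.2 (hd2 _ _ (hre _ h₂) (hre _ h₁)))
    (norm_pos_iff.2 hd3)] at hS
  have hS2 := pow_le_pow_left₀ (by positivity) hS 2
  rw [mul_pow, mul_pow, hid2, norm_sub_rev w₂ w₁, norm_sub_rev (q w₂) (q w₁)] at hS2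
  have : ‖1 - (starRingEnd ℂ) w₁ * w₂‖ ^ 2 = ‖w₁ - w₂‖ ^ 2 + (1 - ‖w₁‖ ^ 2) * (1 - ‖w₂‖ ^ 2) := by
    linarith
  rw [this] at hS2
  nlinarith

lemma lk_key (a : ℝ) (w₁ w₂ p₁ p₂ : ℂ) (h₁ : ‖w₁‖ < 1) (h₂ : ‖w₂‖ < 1)
    (hp₁ : a < p₁.re) (hp₂ : a < p₂.re)
    (hsp : ‖p₁ - p₂‖ ^ 2 * ((1 - ‖w₁‖ ^ 2) * (1 - ‖w₂‖ ^ 2)) ≤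
      4 * ((p₁.re - a) * (p₂.re - a)) * ‖w₁ - w₂‖ ^ 2) :
    |2 * inner ℝ (w₁ - w₂) (-(w₁ * p₁) - -(w₂ * p₂)) + ‖w₁ - w₂‖ ^ 2 * (p₁.re + p₂.re)| ≤
      ‖w₁ - w₂‖ ^ 2 * ((p₁.re - a) * (1 + ‖w₁‖ ^ 2) / (1 - ‖w₁‖ ^ 2) +
        (p₂.re - a) * (1 + ‖w₂‖ ^ 2) / (1 - ‖w₂‖ ^ 2)) := by
  have e : 2 * inner ℝ (w₁ - w₂) (-(w₁ * p₁) - -(w₂ * p₂)) + ‖w₁ - w₂‖ ^ 2 * (p₁.re + p₂.re)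
      = - ((starRingEnd ℂ) (w₁ - w₂) * ((w₁ + w₂) * (p₁ - p₂))).re := by
    rw [Complex.sq_norm, normSq_apply, Complex.inner]
    simp
    ring
  rw [e, abs_neg]
  refine (Complex.abs_re_le_norm _).trans ?_
  rw [norm_mul, RCLike.norm_conj, norm_mul]
  have hs₁ : 0 < 1 - ‖w₁‖ ^ 2 := by nlinarith [norm_nonneg w₁]
  have hs₂ : 0 < 1 - ‖w₂‖ ^ 2 := by nlinarith [norm_nonneg w₂]
  set A₁ := (p₁.re - a) / (1 - ‖w₁‖ ^ 2) with hA₁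
  set A₂ := (p₂.re - a) / (1 - ‖w₂‖ ^ 2) with hA₂
  have hA₁p : 0 < A₁ := div_pos (by linarith) hs₁
  have hA₂p : 0 < A₂ := div_pos (by linarith) hs₂
  have e1 : (p₁.re - a) * (1 + ‖w₁‖ ^ 2) / (1 - ‖w₁‖ ^ 2) = A₁ * (1 + ‖w₁‖ ^ 2) := by
    rw [hA₁]; ring
  have e2 : (p₂.re - a) * (1 + ‖w₂‖ ^ 2) / (1 - ‖w₂‖ ^ 2) = A₂ * (1 + ‖w₂‖ ^ 2) := by
    rw [hA₂]; ring
  rw [e1, e2]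
  have hk : ‖p₁ - p₂‖ ^ 2 ≤ 4 * A₁ * A₂ * ‖w₁ - w₂‖ ^ 2 := by
    have : 4 * A₁ * A₂ * ‖w₁ - w₂‖ ^ 2 =
        (4 * ((p₁.re - a) * (p₂.re - a)) * ‖w₁ - w₂‖ ^ 2) /
          ((1 - ‖w₁‖ ^ 2) * (1 - ‖w₂‖ ^ 2)) := by
      rw [hA₁, hA₂]; field_simp
    rw [this, le_div_iff₀ (mul_pos hs₁ hs₂)]
    exact hsp
  have hr : ‖w₁ + w₂‖ ^ 2 ≤ (1 + ‖w₁‖ ^ 2) * (1 + ‖w₂‖ ^ 2) := by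
    have h1 := pow_le_pow_left₀ (norm_nonneg _) (norm_add_le w₁ w₂) 2
    nlinarith [sq_nonneg (1 - ‖w₁‖ * ‖w₂‖)]
  have hm : ‖w₁ + w₂‖ * ‖p₁ - p₂‖ ≤
      (A₁ * (1 + ‖w₁‖ ^ 2) + A₂ * (1 + ‖w₂‖ ^ 2)) * ‖w₁ - w₂‖ := by
    apply le_of_sq_le_sq _ (by positivity)
    calc (‖w₁ + w₂‖ * ‖p₁ - p₂‖) ^ 2 = ‖w₁ + w₂‖ ^ 2 * ‖p₁ - p₂‖ ^ 2 := by ring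
      _ ≤ ((1 + ‖w₁‖ ^ 2) * (1 + ‖w₂‖ ^ 2)) * (4 * A₁ * A₂ * ‖w₁ - w₂‖ ^ 2) := by gcongr
      _ = (4 * (A₁ * (1 + ‖w₁‖ ^ 2)) * (A₂ * (1 + ‖w₂‖ ^ 2))) * ‖w₁ - w₂‖ ^ 2 := by ring
      _ ≤ (A₁ * (1 + ‖w₁‖ ^ 2) + A₂ * (1 + ‖w₂‖ ^ 2)) ^ 2 * ‖w₁ - w₂‖ ^ 2 := by
        gcongr
        nlinarith [sq_nonneg (A₁ * (1 + ‖w₁‖ ^ 2) - A₂ * (1 + ‖w₂‖ ^ 2))]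
      _ = _ := by ring
  calc _ ≤ ‖w₁ - w₂‖ * ((A₁ * (1 + ‖w₁‖ ^ 2) + A₂ * (1 + ‖w₂‖ ^ 2)) * ‖w₁ - w₂‖) := by gcongr
    _ = _ := by ring

structure LKHyp (a b : ℝ) (p : ℂ → ℝ → ℂ) (w : ℂ → ℝ → ℂ) : Prop where
  ha : 0 < a
  ha1 : a < 1
  hb : 1 < b
  hp_holo : ∀ t ≥ (0 : ℝ), DifferentiableOn ℂ (fun z => p z t) (Metric.ball (0 : ℂ) 1)
  hp_re : ∀ t ≥ (0 : ℝ), ∀ z ∈ Metric.ball (0 : ℂ) 1, a < (p z t).re ∧ (p z t).re < b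
  hw_mem : ∀ z ∈ Metric.ball (0 : ℂ) 1, ∀ t ≥ (0 : ℝ), w z t ∈ Metric.ball (0 : ℂ) 1
  hw_init : ∀ z ∈ Metric.ball (0 : ℂ) 1, w z 0 = z
  hw_deriv : ∀ z ∈ Metric.ball (0 : ℂ) 1, ∀ t ≥ (0 : ℝ),
      HasDerivWithinAt (fun s => w z s) (-(w z t * p (w z t) t)) (Ici (0 : ℝ)) t
  hw_holo : ∀ t ≥ (0 : ℝ), DifferentiableOn ℂ (fun z => w z t) (Metric.ball (0 : ℂ) 1)

lemma LKHyp.key {a b : ℝ} {p w : ℂ → ℝ → ℂ} (H : LKHyp a b p w) (z₁ z₂ : ℂ)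
    (h₁ : z₁ ∈ Metric.ball (0 : ℂ) 1) (h₂ : z₂ ∈ Metric.ball (0 : ℂ) 1) (t : ℝ) (ht : 0 ≤ t) :
    |2 * inner ℝ (w z₁ t - w z₂ t) (-(w z₁ t * p (w z₁ t) t) - -(w z₂ t * p (w z₂ t) t))
      + ‖w z₁ t - w z₂ t‖ ^ 2 * ((p (w z₁ t) t).re + (p (w z₂ t) t).re)| ≤
      ‖w z₁ t - w z₂ t‖ ^ 2 * (((p (w z₁ t) t).re - a) * (1 + ‖w z₁ t‖ ^ 2) / (1 - ‖w z₁ t‖ ^ 2) +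
        ((p (w z₂ t) t).re - a) * (1 + ‖w z₂ t‖ ^ 2) / (1 - ‖w z₂ t‖ ^ 2)) := by
  have m₁ := H.hw_mem z₁ h₁ t ht
  have m₂ := H.hw_mem z₂ h₂ t ht
  apply lk_key a _ _ _ _ (by simpa using m₁) (by simpa using m₂) (H.hp_re t ht _ m₁).1
    (H.hp_re t ht _ m₂).1
  have := lk_sp (fun z => p z t - a) ((H.hp_holo t ht).sub_const _)
    (fun z hz => by simpa using (H.hp_re t ht z hz).1) _ _ m₁ m₂
  simpa using this

lemma LKHyp.lt {a b : ℝ} {p w : ℂ → ℝ → ℂ} (H : LKHyp a b p w) {z : ℂ}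
    (h : z ∈ Metric.ball (0 : ℂ) 1) {t : ℝ} (ht : 0 ≤ t) : 0 < 1 - ‖w z t‖ ^ 2 := by
  have : ‖w z t‖ < 1 := by simpa using H.hw_mem z h t ht
  nlinarith [norm_nonneg (w z t)]

lemma LKHyp.derivU {a b : ℝ} {p w : ℂ → ℝ → ℂ} (H : LKHyp a b p w) {z : ℂ}
    (h : z ∈ Metric.ball (0 : ℂ) 1) {t : ℝ} (ht : 0 ≤ t) :
    HasDerivWithinAt (fun s => ‖w z s‖ ^ 2) (-(2 * (‖w z t‖ ^ 2 * (p (w z t) t).re)))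
      (Ici 0) t := by
  have := (H.hw_deriv z h t ht).norm_sq
  convert this using 1
  rw [Complex.sq_norm, normSq_apply, Complex.inner]
  simp
  ring

lemma LKHyp.derivN {a b : ℝ} {p w : ℂ → ℝ → ℂ} (H : LKHyp a b p w) {z₁ z₂ : ℂ}
    (h₁ : z₁ ∈ Metric.ball (0 : ℂ) 1) (h₂ : z₂ ∈ Metric.ball (0 : ℂ) 1) {t : ℝ} (ht : 0 ≤ t) :
    HasDerivWithinAt (fun s => ‖w z₁ s - w z₂ s‖ ^ 2)
      (2 * inner ℝ (w z₁ t - w z₂ t) (-(w z₁ t * p (w z₁ t) t) - -(w z₂ t * p (w z₂ t) t)))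
      (Ici 0) t :=
  ((H.hw_deriv z₁ h₁ t ht).sub (H.hw_deriv z₂ h₂ t ht)).norm_sq

lemma LKHyp.decay {a b : ℝ} {p w : ℂ → ℝ → ℂ} (H : LKHyp a b p w) {z : ℂ}
    (h : z ∈ Metric.ball (0 : ℂ) 1) {t : ℝ} (ht : 0 ≤ t) :
    ‖w z t‖ ^ 2 ≤ Real.exp (-(2 * a * t)) := by
  have hd : ∀ s ∈ Ici (0 : ℝ), HasDerivWithinAt (fun s => ‖w z s‖ ^ 2 * Real.exp (2 * a * s))
      (-(2 * (‖w z s‖ ^ 2 * (p (w z s) s).re)) * Real.exp (2 * a * s) +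
        ‖w z s‖ ^ 2 * (Real.exp (2 * a * s) * (2 * a))) (Ici 0) s := by
    intro s hs
    have h2 : HasDerivWithinAt (fun s : ℝ => Real.exp (2 * a * s))
        (Real.exp (2 * a * s) * (2 * a)) (Ici 0) s := by
      have : HasDerivAt (fun s : ℝ => 2 * a * s) (2 * a) s := by
        simpa using (hasDerivAt_id s).const_mul (2 * a)
      exact this.exp.hasDerivWithinAt
    exact (H.derivU h hs).mul h2
  have hanti : AntitoneOn (fun s => ‖w z s‖ ^ 2 * Real.exp (2 * a * s)) (Ici 0) := by
    apply antitoneOn_of_hasDerivWithinAt_nonpos (convex_Ici 0)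
      (fun s hs => (hd s hs).continuousWithinAt)
      (fun s hs => (hd s (interior_subset hs)).mono interior_subset)
    intro s hs
    have hs := interior_subset hs
    have hx := (H.hp_re s hs _ (H.hw_mem z h s hs)).1
    have he : 0 ≤ ‖w z s‖ ^ 2 * Real.exp (2 * a * s) := by positivity
    nlinarith
  have := hanti (mem_Ici.2 le_rfl) (mem_Ici.2 ht) ht
  simp only [H.hw_init z h, mul_zero, Real.exp_zero, mul_one] at this
  have hz : ‖z‖ < 1 := by simpa using h
  have hz2 : ‖z‖ ^ 2 ≤ 1 := by nlinarith [norm_nonneg z]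
  rw [Real.exp_neg, ← one_div, le_div_iff₀ (Real.exp_pos _)]
  linarith

lemma LKHyp.fwd {a b : ℝ} {p w : ℂ → ℝ → ℂ} (H : LKHyp a b p w) {z₁ z₂ : ℂ}
    (h₁ : z₁ ∈ Metric.ball (0 : ℂ) 1) (h₂ : z₂ ∈ Metric.ball (0 : ℂ) 1) {t : ℝ} (ht : 0 ≤ t) :
    ‖w z₁ t - w z₂ t‖ ^ 2 ≤ ‖z₁ - z₂‖ ^ 2 *
      ((1 - ‖z₁‖ ^ 2) ^ (-(1 - a / b)) * (1 - ‖z₂‖ ^ 2) ^ (-(1 - a / b))) := by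
  set γ := 1 - a / b with hγ
  have hb0 : 0 < b := by linarith [H.hb]
  have hγ0 : 0 < γ := by
    rw [hγ, sub_pos, div_lt_one hb0]; linarith [H.hb, H.ha1]
  have hL : ∀ z ∈ Metric.ball (0 : ℂ) 1, ∀ s ∈ Ici (0 : ℝ),
      HasDerivWithinAt (fun s => (1 - ‖w z s‖ ^ 2) ^ (-γ))
        (-(γ * (2 * (‖w z s‖ ^ 2 * (p (w z s) s).re) / (1 - ‖w z s‖ ^ 2))) *
          (1 - ‖w z s‖ ^ 2) ^ (-γ)) (Ici 0) s := by
    intro z hz s hs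
    have hp := H.lt hz hs
    have := ((H.derivU hz hs).const_sub 1).rpow_const (p := -γ) (Or.inl hp.ne')
    convert this using 1
    rw [Real.rpow_sub_one hp.ne']
    field_simp
  have hd : ∀ s ∈ Ici (0 : ℝ), HasDerivWithinAt (fun s => ‖w z₁ s - w z₂ s‖ ^ 2 *
      ((1 - ‖w z₁ s‖ ^ 2) ^ (-γ) * (1 - ‖w z₂ s‖ ^ 2) ^ (-γ))) _ (Ici 0) s :=
    fun s hs => (H.derivN h₁ h₂ hs).mul ((hL z₁ h₁ s hs).mul (hL z₂ h₂ s hs))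
  have hanti : AntitoneOn (fun s => ‖w z₁ s - w z₂ s‖ ^ 2 *
      ((1 - ‖w z₁ s‖ ^ 2) ^ (-γ) * (1 - ‖w z₂ s‖ ^ 2) ^ (-γ))) (Ici 0) := by
    apply antitoneOn_of_hasDerivWithinAt_nonpos (convex_Ici 0)
      (fun s hs => (hd s hs).continuousWithinAt)
      (fun s hs => (hd s (interior_subset hs)).mono interior_subset)
    intro s hs
    have hs := interior_subset hs
    have hx₁ := H.hp_re s hs _ (H.hw_mem z₁ h₁ s hs)
    have hx₂ := H.hp_re s hs _ (H.hw_mem z₂ h₂ s hs)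
    have hk := (abs_le.1 (H.key z₁ z₂ h₁ h₂ s hs)).2
    have hu₁ := H.lt h₁ hs
    have hu₂ := H.lt h₂ hs
    generalize inner ℝ (w z₁ s - w z₂ s) (-(w z₁ s * p (w z₁ s) s) - -(w z₂ s * p (w z₂ s) s)) = I
      at *
    have hE₁ : 0 < (1 - ‖w z₁ s‖ ^ 2) ^ (-γ) := Real.rpow_pos_of_pos hu₁ _
    have hE₂ : 0 < (1 - ‖w z₂ s‖ ^ 2) ^ (-γ) := Real.rpow_pos_of_pos hu₂ _
    have hn : 0 ≤ ‖w z₁ s - w z₂ s‖ ^ 2 := by positivity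
    have hn₁ : 0 ≤ ‖w z₁ s‖ ^ 2 := by positivity
    have hn₂ : 0 ≤ ‖w z₂ s‖ ^ 2 := by positivity
    generalize (1 - ‖w z₁ s‖ ^ 2) ^ (-γ) = E₁ at *
    generalize (1 - ‖w z₂ s‖ ^ 2) ^ (-γ) = E₂ at *
    generalize ‖w z₁ s - w z₂ s‖ ^ 2 = n at *
    generalize ‖w z₁ s‖ ^ 2 = u₁ at *
    generalize ‖w z₂ s‖ ^ 2 = u₂ at *
    generalize (p (w z₁ s) s).re = x₁ at *
    generalize (p (w z₂ s) s).re = x₂ at *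
    have hg : ∀ x u : ℝ, a < x → x < b → 0 ≤ u → 0 < 1 - u →
        (x - a) * (1 + u) / (1 - u) - x ≤ γ * (2 * (u * x) / (1 - u)) := by
      intro x u hx hxb hu hu1
      have h1 : x - a ≤ γ * x := by
        have : a / b * x ≤ a := by
          rw [div_mul_eq_mul_div, div_le_iff₀ hb0]; nlinarith [H.ha]
        rw [hγ]; linarith
      have e : (x - a) * (1 + u) / (1 - u) - x = 2 * u / (1 - u) * (x - a) - a := by
        field_simp; ring
      rw [e]
      have : 2 * u / (1 - u) * (x - a) ≤ 2 * u / (1 - u) * (γ * x) := by gcongr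
      have e2 : γ * (2 * (u * x) / (1 - u)) = 2 * u / (1 - u) * (γ * x) := by ring
      linarith [H.ha]
    have g₁ := hg x₁ u₁ hx₁.1 hx₁.2 hn₁ hu₁
    have g₂ := hg x₂ u₂ hx₂.1 hx₂.2 hn₂ hu₂
    generalize γ * (2 * (u₁ * x₁) / (1 - u₁)) = G₁ at *
    generalize γ * (2 * (u₂ * x₂) / (1 - u₂)) = G₂ at *
    have : 2 * I ≤ n * (G₁ + G₂) := by nlinarith
    have hE := mul_pos hE₁ hE₂
    nlinarith
  have h := hanti (mem_Ici.2 le_rfl) (mem_Ici.2 ht) ht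
  simp only [H.hw_init z₁ h₁, H.hw_init z₂ h₂] at h
  refine le_trans ?_ h
  have o : ∀ z ∈ Metric.ball (0 : ℂ) 1, 1 ≤ (1 - ‖w z t‖ ^ 2) ^ (-γ) := by
    intro z hz
    apply Real.one_le_rpow_of_pos_of_le_one_of_nonpos (H.lt hz ht) _ (by linarith)
    linarith [sq_nonneg ‖w z t‖]
  exact le_mul_of_one_le_right (by positivity)
    (one_le_mul_of_one_le_of_one_le (o z₁ h₁) (o z₂ h₂))

lemma LKHyp.bwd {a b : ℝ} {p w : ℂ → ℝ → ℂ} (H : LKHyp a b p w) {s : ℝ} (hs : 0 < s)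
    {t : ℝ} (ht : s ≤ t) :
    ∃ K : ℝ, ∀ z₁ ∈ Metric.ball (0 : ℂ) 1, ∀ z₂ ∈ Metric.ball (0 : ℂ) 1,
      ‖w z₁ s - w z₂ s‖ ^ 2 ≤ K * ‖w z₁ t - w z₂ t‖ ^ 2 := by
  set ρ := Real.exp (-(2 * a * s)) with hρ
  have hb0 : 0 < b := by linarith [H.hb]
  have hρ1 : ρ < 1 := by
    rw [hρ, Real.exp_lt_one_iff]; nlinarith [H.ha, mul_pos H.ha hs]
  have hg : ∀ x u : ℝ, a < x → x < b → 0 ≤ u → u ≤ ρ →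
        (x - a) * (1 + u) / (1 - u) ≤ b * 2 / (1 - ρ) := by
    intro x u hx hxb hu hu1
    have : 0 < 1 - ρ := by linarith
    have h0 := H.ha
    apply div_le_div₀ (by positivity) _ this (by linarith)
    apply mul_le_mul (by linarith) (by linarith) (by linarith) hb0.le
  set L := 2 * b + 2 * (b * 2 / (1 - ρ)) with hLdef
  refine ⟨Real.exp (L * t) / Real.exp (L * s), fun z₁ h₁ z₂ h₂ => ?_⟩
  have hd : ∀ r ∈ Ici s, HasDerivWithinAt (fun s => ‖w z₁ s - w z₂ s‖ ^ 2 * Real.exp (L * s))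
      (2 * inner ℝ (w z₁ r - w z₂ r) (-(w z₁ r * p (w z₁ r) r) - -(w z₂ r * p (w z₂ r) r))
        * Real.exp (L * r) +
        ‖w z₁ r - w z₂ r‖ ^ 2 * (Real.exp (L * r) * L)) (Ici s) r := by
    intro r hr
    have h2 : HasDerivWithinAt (fun s : ℝ => Real.exp (L * s))
        (Real.exp (L * r) * L) (Ici s) r := by
      have : HasDerivAt (fun s : ℝ => L * s) L r := by
        simpa using (hasDerivAt_id r).const_mul L
      exact this.exp.hasDerivWithinAt
    exact ((H.derivN h₁ h₂ (hs.le.trans hr)).mono (Ici_subset_Ici.2 hs.le)).mul h2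
  have hmono : MonotoneOn (fun s => ‖w z₁ s - w z₂ s‖ ^ 2 * Real.exp (L * s)) (Ici s) := by
    apply monotoneOn_of_hasDerivWithinAt_nonneg (convex_Ici s)
      (fun s hs => (hd s hs).continuousWithinAt)
      (fun s hs => (hd s (interior_subset hs)).mono interior_subset)
    intro r hr
    have hr : s ≤ r := interior_subset hr
    have hr0 : 0 ≤ r := hs.le.trans hr
    have hx₁ := H.hp_re r hr0 _ (H.hw_mem z₁ h₁ r hr0)
    have hx₂ := H.hp_re r hr0 _ (H.hw_mem z₂ h₂ r hr0)
    have hk := (abs_le.1 (H.key z₁ z₂ h₁ h₂ r hr0)).1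
    have hρr : Real.exp (-(2 * a * r)) ≤ ρ := by
      rw [hρ, Real.exp_le_exp]; nlinarith [H.ha]
    have g₁ := hg _ _ hx₁.1 hx₁.2 (by positivity) ((H.decay h₁ hr0).trans hρr)
    have g₂ := hg _ _ hx₂.1 hx₂.2 (by positivity) ((H.decay h₂ hr0).trans hρr)
    generalize inner ℝ (w z₁ r - w z₂ r) (-(w z₁ r * p (w z₁ r) r) - -(w z₂ r * p (w z₂ r) r)) = I
      at *
    have hn : 0 ≤ ‖w z₁ r - w z₂ r‖ ^ 2 := by positivity
    have hE := Real.exp_pos (L * r)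
    generalize Real.exp (L * r) = E at *
    generalize ‖w z₁ r - w z₂ r‖ ^ 2 = n at *
    have h3 := mul_le_mul_of_nonneg_left (add_le_add (add_le_add g₁ g₂)
      (add_le_add hx₁.2.le hx₂.2.le)) hn
    have : 0 ≤ 2 * I + n * L := by rw [hLdef]; linarith
    have := mul_nonneg this hE.le
    linarith
  have h := hmono (mem_Ici.2 le_rfl) (mem_Ici.2 ht) ht
  simp only at h
  rw [div_mul_eq_mul_div, le_div_iff₀ (Real.exp_pos _)]
  linarith

open Filter Topology in
lemma LKHyp.lip {a b : ℝ} {p w : ℂ → ℝ → ℂ} (H : LKHyp a b p w) {z₁ z₂ : ℂ} {s : ℝ} (hs : 0 < s)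
    (h₁ : ‖z₁‖ ≤ 1 - s) (h₂ : ‖z₂‖ ≤ 1 - s) {t : ℝ} (ht : 0 ≤ t) :
    ‖w z₁ t - w z₂ t‖ ≤ ‖z₁ - z₂‖ * s ^ (a / b - 1) := by
  have hb0 : 0 < b := by linarith [H.hb]
  have hγ0 : a / b - 1 < 0 := by
    rw [sub_neg, div_lt_one hb0]; linarith [H.hb, H.ha1]
  have m₁ : z₁ ∈ Metric.ball (0 : ℂ) 1 := by rw [mem_ball_zero_iff]; linarith
  have m₂ : z₂ ∈ Metric.ball (0 : ℂ) 1 := by rw [mem_ball_zero_iff]; linarith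
  have h := H.fwd m₁ m₂ ht
  have e : -(1 - a / b) = a / b - 1 := by ring
  rw [e] at h
  have g : ∀ z : ℂ, ‖z‖ ≤ 1 - s → (1 - ‖z‖ ^ 2) ^ (a / b - 1) ≤ s ^ (a / b - 1) := by
    intro z hz
    apply Real.rpow_le_rpow_of_nonpos hs _ hγ0.le
    nlinarith [norm_nonneg z]
  have hp : 0 < s ^ (a / b - 1) := Real.rpow_pos_of_pos hs _
  apply le_of_sq_le_sq _ (by positivity)
  refine h.trans ?_
  rw [mul_pow, sq (s ^ (a / b - 1))]
  have h0 : 0 ≤ (1 - ‖z₂‖ ^ 2) ^ (a / b - 1) := Real.rpow_nonneg (by nlinarith [norm_nonneg z₂]) _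
  exact mul_le_mul_of_nonneg_left (mul_le_mul (g z₁ h₁) (g z₂ h₂) h0 hp.le) (by positivity)

lemma lk_norm {z : ℂ} (hz : z ∈ Metric.closedBall (0 : ℂ) 1) {s : ℝ} (hs : s ≤ 1) :
    ‖((1 - s : ℝ) : ℂ) * z‖ ≤ 1 - s := by
  rw [mem_closedBall_zero_iff] at hz
  rw [norm_mul, Complex.norm_real, Real.norm_of_nonneg (by linarith)]
  nlinarith

lemma lk_mem {z : ℂ} (hz : z ∈ Metric.closedBall (0 : ℂ) 1) {s : ℝ} (hs0 : 0 < s) (hs : s ≤ 1) :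
    ((1 - s : ℝ) : ℂ) * z ∈ Metric.ball (0 : ℂ) 1 := by
  rw [mem_ball_zero_iff]
  linarith [lk_norm hz hs]

open Filter Topology in
lemma LKHyp.radial {a b : ℝ} {p w : ℂ → ℝ → ℂ} (H : LKHyp a b p w) {z : ℂ}
    (hz : z ∈ Metric.closedBall (0 : ℂ) 1) {t : ℝ} (ht : 0 ≤ t) {ε d : ℝ} (hε : 0 < ε)
    (hεd : ε ≤ d) (hd : d ≤ 1) :
    ‖w (((1 - d : ℝ) : ℂ) * z) t - w (((1 - ε : ℝ) : ℂ) * z) t‖ ≤ 2 / (a / b) * d ^ (a / b) := by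
  have hb0 : 0 < b := by linarith [H.hb]
  have hβ : 0 < a / b := div_pos H.ha hb0
  set β := a / b with hβd
  set f : ℝ → ℂ := fun s => w (((1 - s : ℝ) : ℂ) * z) t with hf
  have hL : ∀ x y : ℝ, 0 < x → x ≤ y → y ≤ 1 → ‖f y - f x‖ ≤ (y - x) * x ^ (β - 1) := by
    intro x y hx hxy hy
    have h := H.lip hx ((lk_norm hz hy).trans (by linarith)) (lk_norm hz (hxy.trans hy)) ht
    refine h.trans ?_
    have hp : 0 < x ^ (β - 1) := Real.rpow_pos_of_pos hx _
    gcongr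
    rw [← sub_mul, ← Complex.ofReal_sub, norm_mul, Complex.norm_real, Real.norm_eq_abs]
    rw [mem_closedBall_zero_iff] at hz
    have : |1 - y - (1 - x)| = y - x := by
      rw [abs_of_nonpos (by linarith)]; ring
    rw [this]
    nlinarith [norm_nonneg z]
  have hfc : ContinuousOn f (Icc ε d) := by
    apply (H.hw_holo t ht).continuousOn.comp (f := fun s : ℝ => ((1 - s : ℝ) : ℂ) * z)
    · fun_prop
    · intro s hs
      exact lk_mem hz (hε.trans_le hs.1) (hs.2.trans hd)
  have hBd : ∀ x : ℝ, 0 < x → HasDerivAt (fun s : ℝ => 2 / β * s ^ β) (2 * x ^ (β - 1)) x := by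
    intro x hx
    have := (Real.hasDerivAt_rpow_const (p := β) (Or.inl hx.ne')).const_mul (2 / β)
    rw [← mul_assoc, div_mul_cancel₀ _ hβ.ne'] at this
    exact this
  have key := image_norm_le_of_liminf_right_slope_norm_lt_deriv_boundary
    (f := fun s => f s - f ε) (f' := fun x => x ^ (β - 1)) (a := ε) (b := d)
    (hfc.sub continuousOn_const) ?_ (B := fun s : ℝ => 2 / β * s ^ β)
    (B' := fun x => 2 * x ^ (β - 1)) ?_ ?_ ?_ ?_
  · exact key ⟨hεd, le_rfl⟩
  · intro x hx r hr
    have hx0 : 0 < x := hε.trans_le hx.1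
    apply Eventually.frequently
    have : ∀ᶠ y in 𝓝[>] x, y ∈ Ioo x d := Ioo_mem_nhdsGT hx.2
    filter_upwards [this] with y hy
    refine lt_of_le_of_lt ?_ hr
    rw [slope_def_field, div_le_iff₀ (by linarith [hy.1])]
    have h1 := hL x y hx0 hy.1.le (hy.2.le.trans hd)
    have h2 := norm_sub_norm_le (f y - f ε) (f x - f ε)
    rw [sub_sub_sub_cancel_right] at h2
    simp only [Function.comp]
    linarith
  · have : 0 < ε ^ β := Real.rpow_pos_of_pos hε _
    simp only [sub_self, norm_zero]
    positivity
  · intro x hx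
    exact (hBd x (hε.trans_le hx.1)).continuousAt.continuousWithinAt
  · intro x hx
    exact (hBd x (hε.trans_le hx.1)).hasDerivWithinAt
  · intro x hx _
    have : 0 < x ^ (β - 1) := Real.rpow_pos_of_pos (hε.trans_le hx.1) _
    linarith

lemma lk_eps (n : ℕ) : 0 < (1 / ((n : ℝ) + 1)) ∧ (1 / ((n : ℝ) + 1)) ≤ 1 := by
  refine ⟨by positivity, ?_⟩
  rw [div_le_one (by positivity)]
  linarith [(Nat.cast_nonneg n : (0 : ℝ) ≤ n)]

open Filter Topology in
lemma LKHyp.exists_ext {a b : ℝ} {p w : ℂ → ℝ → ℂ} (H : LKHyp a b p w) {z : ℂ}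
    (hz : z ∈ Metric.closedBall (0 : ℂ) 1) {t : ℝ} (ht : 0 ≤ t) :
    ∃ v : ℂ, Tendsto (fun n : ℕ => w (((1 - 1 / ((n : ℝ) + 1) : ℝ) : ℂ) * z) t) atTop (𝓝 v) := by
  have hb0 : 0 < b := by linarith [H.hb]
  have hβ : 0 < a / b := div_pos H.ha hb0
  apply cauchySeq_tendsto_of_complete
  apply cauchySeq_of_le_tendsto_0
    (fun N : ℕ => 2 * (2 / (a / b) * (1 / ((N : ℝ) + 1)) ^ (a / b)))
  · intro n m N hn hm
    have g : ∀ k : ℕ, N ≤ k → _ := fun k hk =>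
      H.radial hz ht (lk_eps k).1 (one_div_le_one_div_of_le (by positivity)
        (by have : (N : ℝ) ≤ k := by exact_mod_cast hk
            linarith : (N : ℝ) + 1 ≤ (k : ℝ) + 1)) (lk_eps N).2
    have h1 := g n hn
    have h2 := g m hm
    rw [← dist_eq_norm] at h1 h2
    rw [dist_comm] at h1
    linarith [dist_triangle (w (((1 - 1 / ((n : ℝ) + 1) : ℝ) : ℂ) * z) t)
      (w (((1 - 1 / ((N : ℝ) + 1) : ℝ) : ℂ) * z) t) (w (((1 - 1 / ((m : ℝ) + 1) : ℝ) : ℂ) * z) t)]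
  · have h := tendsto_one_div_add_atTop_nhds_zero_nat (𝕜 := ℝ)
    have h2 := ((h.rpow_const (p := a / b) (Or.inr hβ.le)).const_mul (2 / (a / b))).const_mul 2
    simpa [Real.zero_rpow hβ.ne'] using h2

open Filter Topology in
theorem LKHyp.main {a b : ℝ} {p w : ℂ → ℝ → ℂ} (H : LKHyp a b p w) :
    ∀ t ≥ (0 : ℝ), ∃ β ∈ Ioo (0 : ℝ) 1, ∃ M > (0 : ℝ), ∃ W : ℂ → ℂ,
      ContinuousOn W (Metric.closedBall (0 : ℂ) 1) ∧
      InjOn W (Metric.closedBall (0 : ℂ) 1) ∧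
      (∀ z ∈ Metric.ball (0 : ℂ) 1, W z = w z t) ∧
      (∀ z₁ ∈ Metric.closedBall (0 : ℂ) 1, ∀ z₂ ∈ Metric.closedBall (0 : ℂ) 1,
        ‖W z₁ - W z₂‖ ≤ M * ‖z₁ - z₂‖ ^ β) := by
  intro t ht
  have hb0 : 0 < b := by linarith [H.hb]
  have hβ : 0 < a / b := div_pos H.ha hb0
  have hβ1 : a / b < 1 := by rw [div_lt_one hb0]; linarith [H.hb, H.ha1]
  have hex : ∀ (z : ℂ) (s : ℝ), ∃ v : ℂ, z ∈ Metric.closedBall (0 : ℂ) 1 → 0 ≤ s →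
      Tendsto (fun n : ℕ => w (((1 - 1 / ((n : ℝ) + 1) : ℝ) : ℂ) * z) s) atTop (𝓝 v) := by
    intro z s
    by_cases h : z ∈ Metric.closedBall (0 : ℂ) 1 ∧ 0 ≤ s
    · obtain ⟨v, hv⟩ := H.exists_ext h.1 h.2
      exact ⟨v, fun _ _ => hv⟩
    · exact ⟨0, fun h1 h2 => absurd ⟨h1, h2⟩ h⟩
  choose W hW using hex
  have heps := tendsto_one_div_add_atTop_nhds_zero_nat (𝕜 := ℝ)
  set C := 2 / (a / b) with hC
  have hC0 : 0 < C := by positivity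
  have hbd : ∀ z ∈ Metric.closedBall (0 : ℂ) 1, ∀ s, 0 ≤ s → ∀ d, 0 < d → d ≤ 1 →
      ‖w (((1 - d : ℝ) : ℂ) * z) s - W z s‖ ≤ C * d ^ (a / b) := by
    intro z hz s hs d hd hd1
    refine le_of_tendsto ((tendsto_const_nhds.sub (hW z s hz hs)).norm) ?_
    filter_upwards [heps.eventually (gt_mem_nhds hd)] with n hn
    exact H.radial hz hs (lk_eps n).1 hn.le hd1
  have hWin : ∀ z ∈ Metric.ball (0 : ℂ) 1, ∀ s, 0 ≤ s → W z s = w z s := by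
    intro z hz s hs
    refine tendsto_nhds_unique (hW z s (Metric.ball_subset_closedBall hz) hs) ?_
    have hc : ContinuousAt (fun z => w z s) z :=
      (H.hw_holo s hs).continuousOn.continuousAt (Metric.isOpen_ball.mem_nhds hz)
    have h1 : Tendsto (fun n : ℕ => ((1 - 1 / ((n : ℝ) + 1) : ℝ) : ℂ) * z) atTop (𝓝 z) := by
      have h2 : Tendsto (fun n : ℕ => (1 - 1 / ((n : ℝ) + 1) : ℝ)) atTop (𝓝 (1 - 0)) :=
        tendsto_const_nhds.sub heps
      have h3 := ((Complex.continuous_ofReal.tendsto _).comp h2).mul_const z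
      simpa using h3
    exact hc.tendsto.comp h1
  have hclip : ∀ z ∈ Metric.closedBall (0 : ℂ) 1, ∀ s, 0 ≤ s → ‖W z s‖ ≤ 1 := by
    intro z hz s hs
    refine le_of_tendsto (hW z s hz hs).norm (Eventually.of_forall fun n => ?_)
    have := H.hw_mem _ (lk_mem hz (lk_eps n).1 (lk_eps n).2) s hs
    rw [mem_ball_zero_iff] at this
    exact this.le
  have hHol : ∀ z₁ ∈ Metric.closedBall (0 : ℂ) 1, ∀ z₂ ∈ Metric.closedBall (0 : ℂ) 1,
        ‖W z₁ t - W z₂ t‖ ≤ (2 * C + 2) * ‖z₁ - z₂‖ ^ (a / b) := by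
    intro z₁ h₁ z₂ h₂
    rcases eq_or_ne z₁ z₂ with rfl | hne
    · simp; positivity
    have hd0 : 0 < ‖z₁ - z₂‖ := norm_pos_iff.2 (sub_ne_zero.2 hne)
    set d := ‖z₁ - z₂‖ with hd
    rcases le_or_gt d 1 with hd1 | hd1
    · have e1 := hbd z₁ h₁ t ht d hd0 hd1
      have e2 := hbd z₂ h₂ t ht d hd0 hd1
      have e3 := H.lip hd0 (lk_norm h₁ hd1) (lk_norm h₂ hd1) ht
      rw [← mul_sub, norm_mul, Complex.norm_real, Real.norm_of_nonneg (by linarith), ← hd,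
        Real.rpow_sub_one hd0.ne'] at e3
      have e4 : (1 - d) * d * (d ^ (a / b) / d) = (1 - d) * d ^ (a / b) := by field_simp
      rw [e4] at e3
      have hdp : 0 < d ^ (a / b) := Real.rpow_pos_of_pos hd0 _
      have e5 : (1 - d) * d ^ (a / b) ≤ 2 * d ^ (a / b) := by gcongr; linarith
      rw [← dist_eq_norm] at e1 e2 e3 ⊢
      rw [dist_comm] at e1
      have := dist_triangle4 (W z₁ t) (w (((1 - d : ℝ) : ℂ) * z₁) t)
        (w (((1 - d : ℝ) : ℂ) * z₂) t) (W z₂ t)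
      linarith
    · have := norm_sub_le (W z₁ t) (W z₂ t)
      have := hclip z₁ h₁ t ht
      have := hclip z₂ h₂ t ht
      have : 1 ≤ d ^ (a / b) := Real.one_le_rpow hd1.le hβ.le
      nlinarith
  refine ⟨a / b, ⟨hβ, hβ1⟩, 2 * C + 2, by positivity, fun z => W z t, ?_, ?_,
    fun z hz => hWin z hz t ht, hHol⟩
  · intro z hz
    rw [ContinuousWithinAt, tendsto_iff_norm_sub_tendsto_zero]
    have hc : Continuous fun y : ℂ => (2 * C + 2) * ‖y - z‖ ^ (a / b) := by
      apply Continuous.mul continuous_const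
      exact Continuous.rpow_const (by fun_prop) (fun _ => Or.inr hβ.le)
    have h0 : Tendsto (fun y : ℂ => (2 * C + 2) * ‖y - z‖ ^ (a / b))
        (𝓝[Metric.closedBall 0 1] z) (𝓝 0) := by
      have := (hc.tendsto z).mono_left (nhdsWithin_le_nhds (s := Metric.closedBall 0 1))
      simpa [Real.zero_rpow hβ.ne'] using this
    refine squeeze_zero' (Eventually.of_forall fun _ => norm_nonneg _) ?_ h0
    filter_upwards [self_mem_nhdsWithin] with y hy
    exact hHol y hy z hz
  · intro z₁ h₁ z₂ h₂ heq
    simp only at heq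
    -- equality propagates backwards in time
    have hback : ∀ s, 0 < s → s ≤ t → W z₁ s = W z₂ s := by
      intro s hs hst
      obtain ⟨K, hK⟩ := H.bwd hs hst
      have hl := ((hW z₁ s h₁ hs.le).sub (hW z₂ s h₂ hs.le)).norm.pow 2
      have hr := (((hW z₁ t h₁ ht).sub (hW z₂ t h₂ ht)).norm.pow 2).const_mul K
      have := le_of_tendsto_of_tendsto' hl hr (fun n =>
        hK _ (lk_mem h₁ (lk_eps n).1 (lk_eps n).2) _ (lk_mem h₂ (lk_eps n).1 (lk_eps n).2))
      rw [heq, sub_self, norm_zero] at this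
      have h3 : ‖W z₁ s - W z₂ s‖ ^ 2 ≤ 0 := by simpa using this
      have h4 : ‖W z₁ s - W z₂ s‖ = 0 := by
        have := sq_nonneg ‖W z₁ s - W z₂ s‖
        exact pow_eq_zero_iff (two_ne_zero) |>.1 (le_antisymm h3 this)
      exact sub_eq_zero.1 (norm_eq_zero.1 h4)
    have hdz : ∀ d, 0 < d → d ≤ 1 →
        ‖((1 - d : ℝ) : ℂ) * z₁ - ((1 - d : ℝ) : ℂ) * z₂‖ ≤ 2 * (C * d ^ (a / b)) := by
      intro d hd hd1
      have m₁ := lk_mem h₁ hd hd1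
      have m₂ := lk_mem h₂ hd hd1
      have hs : ∀ s, 0 ≤ s → W z₁ s = W z₂ s →
          ‖w (((1 - d : ℝ) : ℂ) * z₁) s - w (((1 - d : ℝ) : ℂ) * z₂) s‖ ≤
            2 * (C * d ^ (a / b)) := by
        intro s hs he
        have e1 := hbd z₁ h₁ s hs d hd hd1
        have e2 := hbd z₂ h₂ s hs d hd hd1
        rw [he] at e1
        rw [← dist_eq_norm] at e1 e2 ⊢
        have := dist_triangle_right (w (((1 - d : ℝ) : ℂ) * z₁) s)
          (w (((1 - d : ℝ) : ℂ) * z₂) s) (W z₂ s)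
        linarith
      rcases ht.lt_or_eq with htp | rfl
      · have c : ∀ z ∈ Metric.ball (0 : ℂ) 1, Tendsto (fun s => w z s) (𝓝[>] 0) (𝓝 z) := by
          intro z hz
          have := (H.hw_deriv z hz 0 le_rfl).continuousWithinAt
          rw [ContinuousWithinAt, H.hw_init z hz] at this
          exact this.mono_left (nhdsWithin_mono _ Ioi_subset_Ici_self)
        refine le_of_tendsto ((c _ m₁).sub (c _ m₂)).norm ?_
        filter_upwards [Ioo_mem_nhdsGT htp] with s hs'
        exact hs s hs'.1.le (hback s hs'.1 hs'.2.le)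
      · have := hs 0 le_rfl heq
        rwa [H.hw_init _ m₁, H.hw_init _ m₂] at this
    have hl : Tendsto (fun n : ℕ => ‖((1 - 1 / ((n : ℝ) + 1) : ℝ) : ℂ) * z₁ -
        ((1 - 1 / ((n : ℝ) + 1) : ℝ) : ℂ) * z₂‖) atTop (𝓝 ‖z₁ - z₂‖) := by
      have h2 : Tendsto (fun n : ℕ => (1 - 1 / ((n : ℝ) + 1) : ℝ)) atTop (𝓝 (1 - 0)) :=
        tendsto_const_nhds.sub heps
      have h3 := (Complex.continuous_ofReal.tendsto _).comp h2
      have h4 := ((h3.mul_const z₁).sub (h3.mul_const z₂)).norm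
      simpa using h4
    have hr : Tendsto (fun n : ℕ => 2 * (C * (1 / ((n : ℝ) + 1)) ^ (a / b))) atTop (𝓝 0) := by
      have h2 := ((heps.rpow_const (p := a / b) (Or.inr hβ.le)).const_mul C).const_mul 2
      simpa [Real.zero_rpow hβ.ne'] using h2
    have := le_of_tendsto_of_tendsto' hl hr (fun n => hdz _ (lk_eps n).1 (lk_eps n).2)
    exact sub_eq_zero.1 (norm_eq_zero.1 (le_antisymm this (norm_nonneg _)))



/-- If the driving term satisfies `a < Re p < b` with `0 < a < 1 < b` and
`p(0,t) = 1`, then for each `t` the univalent solution `z ↦ w(z,t)` of the Loewner–Kufarev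
equation extends to a Hölder-continuous injective map `W` of the closed unit disc; in
particular the boundary of `w(𝔻,t)` is a Jordan curve. -/
theorem loewner_kufarev_strip_jordan
    (a b : ℝ) (ha : 0 < a) (ha1 : a < 1) (hb : 1 < b)
    (p : ℂ → ℝ → ℂ)
    (hp_holo : ∀ t ≥ (0 : ℝ), DifferentiableOn ℂ (fun z => p z t) (Metric.ball (0 : ℂ) 1))
    (hp_one : ∀ t ≥ (0 : ℝ), p 0 t = 1)
    (hp_re : ∀ t ≥ (0 : ℝ), ∀ z ∈ Metric.ball (0 : ℂ) 1,
      a < (p z t).re ∧ (p z t).re < b)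
    (w : ℂ → ℝ → ℂ)
    (hw_mem : ∀ z ∈ Metric.ball (0 : ℂ) 1, ∀ t ≥ (0 : ℝ),
      w z t ∈ Metric.ball (0 : ℂ) 1)
    (hw_init : ∀ z ∈ Metric.ball (0 : ℂ) 1, w z 0 = z)
    (hw_deriv : ∀ z ∈ Metric.ball (0 : ℂ) 1, ∀ t ≥ (0 : ℝ),
      HasDerivWithinAt (fun s => w z s) (-(w z t * p (w z t) t)) (Ici (0 : ℝ)) t)
    (hw_holo : ∀ t ≥ (0 : ℝ), DifferentiableOn ℂ (fun z => w z t) (Metric.ball (0 : ℂ) 1))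
    (hw_inj : ∀ t ≥ (0 : ℝ), InjOn (fun z => w z t) (Metric.ball (0 : ℂ) 1)) :
    ∀ t ≥ (0 : ℝ), ∃ β ∈ Ioo (0 : ℝ) 1, ∃ M > (0 : ℝ), ∃ W : ℂ → ℂ,
      ContinuousOn W (Metric.closedBall (0 : ℂ) 1) ∧
      InjOn W (Metric.closedBall (0 : ℂ) 1) ∧
      (∀ z ∈ Metric.ball (0 : ℂ) 1, W z = w z t) ∧
      (∀ z₁ ∈ Metric.closedBall (0 : ℂ) 1, ∀ z₂ ∈ Metric.closedBall (0 : ℂ) 1,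
        ‖W z₁ - W z₂‖ ≤ M * ‖z₁ - z₂‖ ^ β) := by
  exact LKHyp.main ⟨ha, ha1, hb, hp_holo, hp_re, hw_mem, hw_init, hw_deriv, hw_holo⟩
end

section
/- Let C > 0 and set α = (2/π)·arctan C. Let p be holomorphic on the open unit disc 𝔻 with Re p(z) > 0 and |Im p(z)| ≤ C·Re p(z) for all z ∈ 𝔻. Then (1−|z|²)·|p'(z)| ≤ 2α · Re p(z) for all z ∈ 𝔻. -/
open Complex Set Real

lemma aux_schwarz_pick (q : ℂ → ℂ) (hq : DifferentiableOn ℂ q (Metric.ball (0 : ℂ) 1))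
    (hre : ∀ z ∈ Metric.ball (0 : ℂ) 1, 0 < (q z).re) (a : ℂ)
    (ha : a ∈ Metric.ball (0 : ℂ) 1) :
    (1 - ‖a‖ ^ 2) * ‖deriv q a‖ ≤ 2 * (q a).re := by
  have ha1 : ‖a‖ < 1 := by simpa using ha
  have hns : ∀ w : ℂ, ‖w‖ ^ 2 = w.re ^ 2 + w.im ^ 2 := fun w => by
    rw [Complex.sq_norm, Complex.normSq_apply]; ring
  have hden : ∀ w ∈ Metric.ball (0 : ℂ) 1, 1 + (starRingEnd ℂ) a * w ≠ 0 := by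
    intro w hw h
    have hw1 : ‖w‖ < 1 := by simpa using hw
    have h2 : (starRingEnd ℂ) a * w = -1 := by linear_combination h
    have h3 := congrArg norm h2
    rw [norm_mul, Complex.norm_conj, norm_neg, norm_one] at h3
    nlinarith [norm_nonneg a, norm_nonneg w]
  set φ : ℂ → ℂ := fun w => (w + a) / (1 + (starRingEnd ℂ) a * w) with hφ
  have hφm : MapsTo φ (Metric.ball (0 : ℂ) 1) (Metric.ball (0 : ℂ) 1) := by
    intro w hw
    have hw1 : ‖w‖ < 1 := by simpa using hw
    have hd := hden w hw
    simp only [hφ, mem_ball_zero_iff, norm_div]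
    rw [div_lt_one (norm_pos_iff.mpr hd)]
    apply lt_of_pow_lt_pow_left₀ 2 (norm_nonneg _)
    have e : ‖1 + (starRingEnd ℂ) a * w‖ ^ 2 - ‖w + a‖ ^ 2 = (1 - ‖a‖ ^ 2) * (1 - ‖w‖ ^ 2) := by
      simp only [hns]; simp; ring
    have h1 : 0 < 1 - ‖a‖ ^ 2 := by nlinarith [norm_nonneg a]
    have h2 : 0 < 1 - ‖w‖ ^ 2 := by nlinarith [norm_nonneg w]
    nlinarith [mul_pos h1 h2]
  have hφd : ∀ w ∈ Metric.ball (0 : ℂ) 1, DifferentiableAt ℂ φ w := by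
    intro w hw
    have hd := hden w hw
    simp only [hφ]
    fun_prop (disch := assumption)
  have hφ0 : φ 0 = a := by simp [hφ]
  have hφ' : HasDerivAt φ (1 - (‖a‖ : ℂ) ^ 2) 0 := by
    have h1 : HasDerivAt (fun w : ℂ => w + a) 1 0 := (hasDerivAt_id _).add_const _
    have h2 : HasDerivAt (fun w : ℂ => 1 + (starRingEnd ℂ) a * w) ((starRingEnd ℂ) a) 0 := by
      simpa using ((hasDerivAt_id (0:ℂ)).const_mul ((starRingEnd ℂ) a)).const_add 1
    have h3 := h1.div h2 (by simp)
    have e : (1 * (1 + (starRingEnd ℂ) a * 0) - (0 + a) * (starRingEnd ℂ) a) /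
        (1 + (starRingEnd ℂ) a * 0) ^ 2 = 1 - (‖a‖ : ℂ) ^ 2 := by
      rw [← Complex.mul_conj']; simp
    rw [e] at h3
    exact h3
  have hqa := hre a ha
  have hden2 : ∀ w ∈ Metric.ball (0 : ℂ) 1, q w + (starRingEnd ℂ) (q a) ≠ 0 := by
    intro w hw h
    have h2 := congrArg Complex.re h
    have := hre w hw
    simp at h2
    linarith
  have hqd : ∀ w ∈ Metric.ball (0 : ℂ) 1, DifferentiableAt ℂ q w := fun w hw =>
    hq.differentiableAt (Metric.isOpen_ball.mem_nhds hw)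
  set G : ℂ → ℂ := fun w => (q (φ w) - q a) / (q (φ w) + (starRingEnd ℂ) (q a)) with hG
  have hGd : DifferentiableOn ℂ G (Metric.ball (0 : ℂ) 1) := by
    intro w hw
    have h1 : DifferentiableAt ℂ (fun w => q (φ w)) w :=
      (hqd _ (hφm hw)).comp w (hφd w hw)
    exact ((h1.sub_const _).div (h1.add_const _) (hden2 _ (hφm hw))).differentiableWithinAt
  have hG0 : G 0 = 0 := by simp [hG, hφ0]
  have hGm : MapsTo G (Metric.ball (0 : ℂ) 1) (Metric.ball (G 0) 1) := by
    intro w hw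
    have hd := hden2 _ (hφm hw)
    have hr := hre _ (hφm hw)
    rw [hG0]
    simp only [hG, mem_ball_zero_iff, norm_div]
    rw [div_lt_one (norm_pos_iff.mpr hd)]
    apply lt_of_pow_lt_pow_left₀ 2 (norm_nonneg _)
    have e : ‖q (φ w) + (starRingEnd ℂ) (q a)‖ ^ 2 - ‖q (φ w) - q a‖ ^ 2
        = 4 * ((q (φ w)).re * (q a).re) := by
      simp only [hns]; simp; ring
    nlinarith [mul_pos hr hqa]
  have hG' : HasDerivAt G (deriv q a * (1 - (‖a‖ : ℂ) ^ 2) / (2 * (q a).re : ℝ)) 0 := by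
    have hq' : HasDerivAt q (deriv q a) (φ 0) := by
      rw [hφ0]; exact (hqd a ha).hasDerivAt
    have h1 := hq'.comp (0:ℂ) hφ'
    have h2 := (h1.sub_const (q a)).div (h1.add_const ((starRingEnd ℂ) (q a)))
      (by simpa [hφ0] using hden2 a ha)
    have := hden2 a ha
    simp only [Function.comp, hφ0, sub_self, zero_mul, sub_zero] at h2
    rw [← Complex.add_conj]
    have e : deriv q a * (1 - (‖a‖ : ℂ) ^ 2) / (q a + (starRingEnd ℂ) (q a)) =
        deriv q a * (1 - (‖a‖ : ℂ) ^ 2) * (q a + (starRingEnd ℂ) (q a)) /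
          (q a + (starRingEnd ℂ) (q a)) ^ 2 := by
      field_simp
    rw [e]
    exact h2
  have key := Complex.norm_deriv_le_one_of_mapsTo_ball hGd 
    (hGm.mono_right (by first | exact subset_rfl | exact Metric.ball_subset_closedBall)) one_pos
  rw [hG'.deriv, norm_div, norm_mul, Complex.norm_real, Real.norm_of_nonneg (by positivity),
    div_le_one (by positivity)] at key
  have h1 : 0 < 1 - ‖a‖ ^ 2 := by nlinarith [norm_nonneg a]
  have : ‖(1 - (‖a‖ : ℂ) ^ 2)‖ = 1 - ‖a‖ ^ 2 := by
    have : (1 - (‖a‖ : ℂ) ^ 2) = ((1 - ‖a‖ ^ 2 : ℝ) : ℂ) := by push_cast; rfl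
    rw [this, Complex.norm_real, Real.norm_of_nonneg h1.le]
  rw [this] at key
  linarith

lemma aux_beta (C : ℝ) (p : ℂ → ℂ)
    (hp : DifferentiableOn ℂ p (Metric.ball (0 : ℂ) 1))
    (hp_re : ∀ z ∈ Metric.ball (0 : ℂ) 1, 0 < (p z).re)
    (hp_sector : ∀ z ∈ Metric.ball (0 : ℂ) 1, |(p z).im| ≤ C * (p z).re)
    (β : ℝ) (hβ0 : 0 < β) (hβ1 : β < 1) (hβ : (2 / π) * Real.arctan C < β)
    (z : ℂ) (hz : z ∈ Metric.ball (0 : ℂ) 1) :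
    (1 - ‖z‖ ^ 2) * ‖deriv p z‖ ≤ 2 * β * (p z).re := by
  have hz1 : ‖z‖ < 1 := by simpa using hz
  have harg : ∀ w ∈ Metric.ball (0 : ℂ) 1, |(p w).arg| / β < π / 2 := by
    intro w hw
    have hr := hp_re w hw
    have hs := abs_le.mp (hp_sector w hw)
    have h1 : |(p w).arg| ≤ Real.arctan C := by
      have e : (p w).arg = Real.arctan ((p w).im / (p w).re) := by
        rw [← Complex.tan_arg, Real.arctan_tan]
        · have := Complex.abs_arg_lt_pi_div_two_iff.mpr (Or.inl hr)
          exact (abs_lt.mp this).1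
        · have := Complex.abs_arg_lt_pi_div_two_iff.mpr (Or.inl hr)
          exact (abs_lt.mp this).2
      rw [e, abs_le, ← Real.arctan_neg]
      constructor
      · apply Real.arctan_mono
        rw [le_div_iff₀ hr]; linarith [hs.1]
      · apply Real.arctan_mono
        rw [div_le_iff₀ hr]; linarith [hs.2]
    rw [div_lt_iff₀ hβ0]
    have h2 : Real.arctan C < β * (π / 2) := by
      have := mul_lt_mul_of_pos_right hβ (show (0:ℝ) < π / 2 by positivity)
      have e : 2 / π * Real.arctan C * (π / 2) = Real.arctan C := by
        field_simp
      linarith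
    linarith
  have hslit : ∀ w ∈ Metric.ball (0 : ℂ) 1, p w ∈ Complex.slitPlane := fun w hw =>
    Or.inl (hp_re w hw)
  have hpd : ∀ w ∈ Metric.ball (0 : ℂ) 1, DifferentiableAt ℂ p w := fun w hw =>
    hp.differentiableAt (Metric.isOpen_ball.mem_nhds hw)
  set q : ℂ → ℂ := fun w => Complex.exp (Complex.log (p w) / (β : ℂ)) with hq
  have hq' : ∀ w ∈ Metric.ball (0 : ℂ) 1, HasDerivAt q (q w * (deriv p w / p w / β)) w :=
    fun w hw => (((hpd w hw).hasDerivAt.clog (hslit w hw)).div_const (β : ℂ)).cexp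
  have hqre : ∀ w, (q w).re = ‖q w‖ * Real.cos ((p w).arg / β) := by
    intro w
    simp only [hq, Complex.norm_exp]
    rw [Complex.exp_re, Complex.div_ofReal_im, Complex.log_im]
  have hqn : ∀ w, 0 < ‖q w‖ := fun w => norm_pos_iff.mpr (Complex.exp_ne_zero _)
  have hqpos : ∀ w ∈ Metric.ball (0 : ℂ) 1, 0 < (q w).re := by
    intro w hw
    rw [hqre]
    refine mul_pos (hqn w) (Real.cos_pos_of_mem_Ioo ?_)
    have := harg w hw
    have e : |(p w).arg / β| = |(p w).arg| / β := by rw [abs_div, abs_of_pos hβ0]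
    rw [← e] at this
    exact abs_lt.mp this
  have key := aux_schwarz_pick q
    (fun w hw => (hq' w hw).differentiableAt.differentiableWithinAt) hqpos z hz
  have hp0 : 0 < ‖p z‖ := norm_pos_iff.mpr (Complex.slitPlane_ne_zero (hslit z hz))
  have hcos : Real.cos ((p z).arg / β) ≤ Real.cos (p z).arg := by
    rw [← Real.cos_abs, ← Real.cos_abs (p z).arg, abs_div, abs_of_pos hβ0]
    apply Real.cos_le_cos_of_nonneg_of_le_pi (abs_nonneg _)
    · linarith [harg z hz, Real.pi_pos]
    · rw [le_div_iff₀ hβ0]; nlinarith [abs_nonneg (p z).arg]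
  have hre : (p z).re = ‖p z‖ * Real.cos (p z).arg := (Complex.norm_mul_cos_arg _).symm
  rw [(hq' z hz).deriv, hqre, norm_mul, norm_div, norm_div, Complex.norm_real,
    Real.norm_of_nonneg hβ0.le] at key
  have k2 : (1 - ‖z‖ ^ 2) * (‖deriv p z‖ / ‖p z‖ / β) ≤ 2 * Real.cos ((p z).arg / β) := by
    apply le_of_mul_le_mul_left _ (hqn z)
    linarith
  have k3 : (1 - ‖z‖ ^ 2) * (‖deriv p z‖ / ‖p z‖ / β) ≤ 2 * Real.cos (p z).arg := by linarith
  have k4 := mul_le_mul_of_nonneg_right k3 (mul_pos hp0 hβ0).le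
  have e : (1 - ‖z‖ ^ 2) * (‖deriv p z‖ / ‖p z‖ / β) * (‖p z‖ * β)
      = (1 - ‖z‖ ^ 2) * ‖deriv p z‖ := by field_simp
  rw [e] at k4
  rw [hre]
  linarith

/-- If `p` is holomorphic on the unit disc with values in the sector
`|Im p| ≤ C·Re p`, `Re p > 0`, and `α = (2/π)·arctan C`, then
`(1-|z|²)|p'(z)| ≤ 2α·Re p(z)` for all `z` in the disc. -/
theorem sector_class_char_bound
    (C : ℝ) (hC : 0 < C)
    (p : ℂ → ℂ)
    (hp : DifferentiableOn ℂ p (Metric.ball (0 : ℂ) 1))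
    (hp_re : ∀ z ∈ Metric.ball (0 : ℂ) 1, 0 < (p z).re)
    (hp_sector : ∀ z ∈ Metric.ball (0 : ℂ) 1, |(p z).im| ≤ C * (p z).re) :
    ∀ z ∈ Metric.ball (0 : ℂ) 1,
      (1 - ‖z‖ ^ 2) * ‖deriv p z‖ ≤ 2 * ((2 / π) * Real.arctan C) * (p z).re := by
  intro z hz
  have hr := hp_re z hz
  have ha0 : 0 < (2 / π) * Real.arctan C := by
    have := Real.arctan_pos.mpr hC
    positivity
  have ha1 : (2 / π) * Real.arctan C < 1 := by
    have := Real.arctan_lt_pi_div_two C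
    have hpi := Real.pi_pos
    rw [div_mul_eq_mul_div, div_lt_one hpi]
    linarith
  have h : (1 - ‖z‖ ^ 2) * ‖deriv p z‖ / (2 * (p z).re) ≤ (2 / π) * Real.arctan C := by
    apply le_of_forall_gt_imp_ge_of_dense
    intro b hb
    rcases lt_or_ge b 1 with h1 | h1
    · rw [div_le_iff₀ (by positivity)]
      have := aux_beta C p hp hp_re hp_sector b (ha0.trans hb) h1 hb z hz
      linarith
    · obtain ⟨c, hc, hc1⟩ := exists_between ha1
      have := aux_beta C p hp hp_re hp_sector c (ha0.trans hc) hc1 hc z hz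
      refine le_trans ?_ (hc1.le.trans h1)
      rw [div_le_iff₀ (by positivity)]
      linarith
  rw [div_le_iff₀ (by positivity)] at h
  linarith
end

section
/- Let 0 < α < 1 and define p(z) = ((1+z)/(1−z))^α on the open unit disc 𝔻, using the principal branch of the power (note (1+z)/(1−z) has positive real part on 𝔻). Then ℋ(p) = sup_{|z|<1} (1−|z|²)·|p'(z)| / Re p(z) = 2α. -/
open Complex Set

/-- The characteristic `ℋ(q) = sup_{|z|<1} (1-|z|²)|q'(z)| / Re q(z)`, taken in `[0,∞]`. -/
noncomputable def loewnerChar (q : ℂ → ℂ) : ENNReal :=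
  ⨆ z ∈ Metric.ball (0 : ℂ) 1,
    ENNReal.ofReal ((1 - ‖z‖ ^ 2) * ‖deriv q z‖ / (q z).re)

lemma sector_deriv_aux (α : ℝ) (z : ℂ) (hz : ‖z‖ < 1) :
    0 < ((1 + z) / (1 - z)).re ∧
    (1 - ‖z‖ ^ 2) * ‖deriv (fun z : ℂ => ((1 + z) / (1 - z)) ^ (α : ℂ)) z‖
      = 2 * |α| * ‖(1 + z) / (1 - z)‖ ^ α * Real.cos (arg ((1 + z) / (1 - z))) := by
  have h1 : (1 - z) ≠ 0 := by
    intro h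
    have : z = 1 := by linear_combination -h
    simp [this] at hz
  have hn : 0 < normSq (1 - z) := normSq_pos.2 h1
  have hre : ((1 + z) / (1 - z)).re * normSq (1 - z) = 1 - ‖z‖ ^ 2 := by
    rw [div_re, ← normSq_eq_norm_sq]
    field_simp
    simp [normSq_apply]
    ring
  have hpos : 0 < ((1 + z) / (1 - z)).re := by
    have : 0 < 1 - ‖z‖ ^ 2 := by nlinarith [norm_nonneg z]
    rw [← hre] at this
    exact pos_of_mul_pos_left this hn.le
  refine ⟨hpos, ?_⟩
  have hd : HasDerivAt (fun z : ℂ => (1 + z) / (1 - z)) (2 / (1 - z) ^ 2) z := by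
    have := ((hasDerivAt_id z).const_add 1).div ((hasDerivAt_id z).const_sub 1) h1
    refine this.congr_deriv ?_
    simp only [id]
    ring
  have hd2 := hd.cpow_const (c := (α : ℂ)) (Or.inl hpos)
  rw [hd2.deriv, ← hre]
  have hw : (1 + z) / (1 - z) ≠ 0 := by
    intro h
    simp [h] at hpos
  generalize (1 + z) / (1 - z) = w at *
  have hwn : 0 < ‖w‖ := norm_pos_iff.2 hw
  rw [cpow_sub _ _ hw, cpow_one, norm_mul, norm_mul, norm_div, norm_div, norm_pow,
    norm_cpow_real, normSq_eq_norm_sq, ← norm_mul_cos_arg w]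
  have h2 : 0 < ‖1 - z‖ := norm_pos_iff.2 h1
  simp
  field_simp
  rw [← norm_mul_cos_arg w]
  ring

/-- For `0 < α < 1` and the principal-branch sector map
`p(z) = ((1+z)/(1-z))^α`, one has `ℋ(p) = 2α`. -/
theorem loewnerChar_sector_map
    (α : ℝ) (hα : 0 < α) (hα1 : α < 1) :
    loewnerChar (fun z : ℂ => ((1 + z) / (1 - z)) ^ (α : ℂ)) = ENNReal.ofReal (2 * α) := by
  unfold loewnerChar
  apply le_antisymm
  · refine iSup₂_le fun z hz => ENNReal.ofReal_le_ofReal ?_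
    obtain ⟨hpos, he⟩ := sector_deriv_aux α z (by simpa using hz)
    rw [he, abs_of_pos hα, cpow_ofReal_re]
    generalize (1 + z) / (1 - z) = w at *
    have hwn : 0 < ‖w‖ := norm_pos_iff.2 (by rintro rfl; simp at hpos)
    have harg : |arg w| < Real.pi / 2 := abs_arg_lt_pi_div_two_iff.2 (Or.inl hpos)
    have hcos : Real.cos (arg w) ≤ Real.cos (arg w * α) := by
      rw [← Real.cos_abs (arg w), ← Real.cos_abs (arg w * α), abs_mul, abs_of_pos hα]
      apply Real.cos_le_cos_of_nonneg_of_le_pi (by positivity) (by linarith [Real.pi_pos])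
      nlinarith [abs_nonneg (arg w)]
    have hc0 : 0 < Real.cos (arg w) := Real.cos_pos_of_mem_Ioo (abs_lt.1 harg |>.imp (by intro h; linarith) id)
    have hr : 0 < ‖w‖ ^ α := Real.rpow_pos_of_pos hwn α
    rw [div_le_iff₀ (mul_pos hr (hc0.trans_le hcos)), ← mul_assoc]
    exact mul_le_mul_of_nonneg_left hcos (by positivity)
  · refine le_trans ?_ (le_iSup₂ (0 : ℂ) (by simp))
    rw [(sector_deriv_aux α 0 (by simp)).2]
    simp [abs_of_pos hα]
end

section
/- Let 0 < α < 1. For every z in the open unit disc 𝔻 with r = |z|, the principal-branch power satisfies Re( ((1+z)/(1−z))^α ) ≥ ((1−r)/(1+r))^α. -/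
open Complex Set

lemma concave_log_cos_aux :
    ConcaveOn ℝ (Ioo (-(Real.pi/2)) (Real.pi/2)) (fun x => Real.log (Real.cos x)) := by
  have hd : ∀ x ∈ Ioo (-(Real.pi/2)) (Real.pi/2),
      HasDerivAt (fun x => Real.log (Real.cos x)) (-Real.tan x) x := by
    intro x hx
    have hc := Real.cos_pos_of_mem_Ioo hx
    have := (Real.hasDerivAt_cos x).log hc.ne'
    rwa [neg_div, ← Real.tan_eq_sin_div_cos] at this
  apply AntitoneOn.concaveOn_of_deriv (convex_Ioo _ _)
  · exact fun x hx => (hd x hx).continuousAt.continuousWithinAt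
  · rw [interior_Ioo]
    exact fun x hx => (hd x hx).differentiableAt.differentiableWithinAt
  · rw [interior_Ioo]
    intro x hx y hy hxy
    rw [(hd x hx).deriv, (hd y hy).deriv]
    exact neg_le_neg (Real.strictMonoOn_tan.monotoneOn hx hy hxy)

lemma cos_rpow_le_aux (α : ℝ) (hα : 0 < α) (hα1 : α < 1) (t : ℝ)
    (ht : t ∈ Ioo (-(Real.pi/2)) (Real.pi/2)) :
    (Real.cos t) ^ α ≤ Real.cos (α * t) := by
  have hp := Real.pi_pos
  have h0 : (0:ℝ) ∈ Ioo (-(Real.pi/2)) (Real.pi/2) := ⟨by linarith, by linarith⟩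
  have h := concave_log_cos_aux.2 ht h0 hα.le (sub_nonneg.2 hα1.le) (by ring)
  have hm := concave_log_cos_aux.1 ht h0 hα.le (sub_nonneg.2 hα1.le) (by ring)
  simp only [smul_eq_mul, mul_zero, add_zero, Real.cos_zero, Real.log_one] at h hm
  have hc := Real.cos_pos_of_mem_Ioo ht
  have hc' := Real.cos_pos_of_mem_Ioo hm
  rw [Real.rpow_def_of_pos hc, ← Real.le_log_iff_exp_le hc']
  linarith

/-- For `0 < α < 1` and `z` in the unit disc with `r = |z|`, the
principal-branch power satisfies `Re(((1+z)/(1-z))^α) ≥ ((1-r)/(1+r))^α`. -/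
theorem sector_map_re_lower_bound
    (α : ℝ) (hα : 0 < α) (hα1 : α < 1) :
    ∀ z ∈ Metric.ball (0 : ℂ) 1,
      ((1 - ‖z‖) / (1 + ‖z‖)) ^ α ≤ ((((1 + z) / (1 - z)) ^ (α : ℂ)).re) := by
  intro z hz
  have hr : ‖z‖ < 1 := by simpa using hz
  have hr0 := norm_nonneg z
  have hne : (1 - z) ≠ 0 := by
    intro h
    have : z = 1 := (sub_eq_zero.1 h).symm
    simp [this] at hr
  have hpos : 0 < ‖1 - z‖ := norm_pos_iff.2 hne
  have hle : ‖1 - z‖ ≤ 1 + ‖z‖ := by simpa using norm_sub_le (1:ℂ) z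
  have hre : ((1 + z) / (1 - z)).re = (1 - ‖z‖^2) / ‖1 - z‖^2 := by
    have e1 := Complex.normSq_eq_norm_sq z
    have e2 := Complex.normSq_eq_norm_sq (1 - z)
    rw [Complex.div_re, ← e1, ← e2, ← add_div]
    congr 1
    simp [Complex.normSq_apply]
    ring
  have hlow : (1 - ‖z‖) / (1 + ‖z‖) ≤ ((1 + z) / (1 - z)).re := by
    rw [hre]
    have : (1 - ‖z‖) / (1 + ‖z‖) = (1 - ‖z‖^2) / (1 + ‖z‖)^2 := by
      field_simp
      ring
    rw [this]
    have : 0 ≤ 1 - ‖z‖^2 := by nlinarith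
    gcongr
  have hl0 : 0 < (1 - ‖z‖) / (1 + ‖z‖) := div_pos (by linarith) (by linarith)
  generalize (1 + z) / (1 - z) = w at *
  have hw : 0 < w.re := by linarith
  have hw0 : w ≠ 0 := by
    rintro rfl
    simp at hw
  have harg : w.arg ∈ Ioo (-(Real.pi/2)) (Real.pi/2) :=
    abs_lt.1 (Complex.abs_arg_lt_pi_div_two_iff.2 (Or.inl hw))
  have key : (w ^ (α : ℂ)).re = ‖w‖ ^ α * Real.cos (α * w.arg) := by
    rw [Complex.cpow_ofReal_re, mul_comm α]
  rw [key]
  have hc := Real.cos_pos_of_mem_Ioo harg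
  calc _ ≤ w.re ^ α := Real.rpow_le_rpow hl0.le hlow hα.le
    _ = (‖w‖ * Real.cos w.arg) ^ α := by rw [Complex.norm_mul_cos_arg]
    _ = ‖w‖ ^ α * Real.cos w.arg ^ α := Real.mul_rpow (norm_nonneg _) hc.le
    _ ≤ _ := by
      gcongr
      exact cos_rpow_le_aux α hα hα1 _ harg
end
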